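/- arXiv:1010.0152 — 5 statements merged into one kernel-verified Lean document; each statement's English description precedes it below -/
import Mathlib

section
/- Let k be a finite field with q elements of characteristic p > 3 and let m ≥ 1 be an integer. Then the set S of tuples (a, α, b, β) ∈ k × k^m × k × k^m for which there exist x, y ∈ k with y² = x³ + a·x + b, 2y = 0, 3x² + a = 0, and α_j·x + β_j = 0 for all j = 1,…,m, has exactly q^{m+1} elements. Consequently the proportion of such 'singular jets' among all q^{2(m+1)} tuples is q^{-(m+1)}. -/
noncomputable section

/-- The set of 'singular jets' `(a, α, b, β)`: the Weierstrass hypersurface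
`y² = x³ + a₄x + a₆` is singular at a point in the fiber over a base point where
`a₄` has value `a` and partials `α`, and `a₆` has value `b` and partials `β`. -/
def SingJets (k : Type) [Field k] (m : ℕ) :
    Set ((k × (Fin m → k)) × (k × (Fin m → k))) :=
  {t | ∃ x y : k,
    y ^ 2 = x ^ 3 + t.1.1 * x + t.2.1 ∧
    2 * y = 0 ∧
    3 * x ^ 2 + t.1.1 = 0 ∧
    ∀ j, t.1.2 j * x + t.2.2 j = 0}

/-- The jet singular at the point `(x, 0)` of the fiber with prescribed partials `α` of `a₄`. -/
def singJet (k : Type) [Field k] (m : ℕ) (t : k × (Fin m → k)) :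
    (k × (Fin m → k)) × (k × (Fin m → k)) :=
  ((-3 * t.1 ^ 2, t.2), (2 * t.1 ^ 3, fun j => -(t.2 j * t.1)))

theorem eq_of_sq_eq_of_cube_eq {k : Type*} [Field k] {x y : k} (h2 : x ^ 2 = y ^ 2)
    (h3 : x ^ 3 = y ^ 3) : x = y := by
  by_cases hy : y = 0
  · subst hy
    simpa using h2
  · apply mul_right_cancel₀ (pow_ne_zero 2 hy)
    linear_combination h3 - x * h2

theorem singJet_injective {k : Type} [Field k] (m : ℕ) (h2 : (2 : k) ≠ 0) (h3 : (3 : k) ≠ 0) :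
    Function.Injective (singJet k m) := by
  rintro ⟨x, α⟩ ⟨y, β⟩ h
  simp only [singJet, Prod.mk.injEq] at h
  obtain ⟨⟨ha, hα⟩, hb, -⟩ := h
  exact Prod.ext (eq_of_sq_eq_of_cube_eq (mul_left_cancel₀ (neg_ne_zero.mpr h3) ha)
    (mul_left_cancel₀ h2 hb)) hα

theorem range_singJet {k : Type} [Field k] (m : ℕ) (h2 : (2 : k) ≠ 0) :
    Set.range (singJet k m) = SingJets k m := by
  ext ⟨⟨a, α⟩, b, β⟩
  constructor
  · rintro ⟨⟨x, γ⟩, h⟩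
    simp only [singJet, Prod.mk.injEq] at h
    obtain ⟨⟨rfl, rfl⟩, rfl, rfl⟩ := h
    exact ⟨x, 0, by ring, by ring, by ring, fun j => by ring⟩
  · rintro ⟨x, y, h, hy, ha, hβ⟩
    have hy0 : y = 0 := (mul_eq_zero.mp hy).resolve_left h2
    subst hy0
    dsimp only at h ha hβ
    refine ⟨(x, α), ?_⟩
    simp only [singJet, Prod.mk.injEq, and_true]
    refine ⟨?_, ?_, ?_⟩
    · linear_combination -ha
    · linear_combination h + x * ha
    · funext j
      linear_combination -hβ j

theorem card_singJets {k : Type} [Field k] [Fintype k] (m : ℕ) (h2 : (2 : k) ≠ 0)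
    (h3 : (3 : k) ≠ 0) : Nat.card (SingJets k m) = Fintype.card k ^ (m + 1) := by
  rw [← range_singJet m h2, Nat.card_range_of_injective (singJet_injective m h2 h3)]
  simp [pow_succ']

/-- over a finite field of characteristic `p > 3` with `q` elements,
the set of singular jets has exactly `q^(m+1)` elements; consequently its
proportion among all `q^(2(m+1))` jets is `q^(-(m+1))`. -/
theorem stmt5 (k : Type) [Field k] [Fintype k] (p : ℕ) (hp : p.Prime) (hp3 : 3 < p)
    [CharP k p] (m : ℕ) (hm : 1 ≤ m) :
    Nat.card (SingJets k m) = Fintype.card k ^ (m + 1) ∧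
    (Nat.card (SingJets k m) : ℝ) / (Fintype.card k : ℝ) ^ (2 * (m + 1)) =
      ((Fintype.card k : ℝ) ^ (m + 1))⁻¹ := by
  have natCast_ne_zero : ∀ n : ℕ, 0 < n → n < p → (n : k) ≠ 0 := fun n hn hnp h =>
    Nat.not_dvd_of_pos_of_lt hn hnp ((CharP.cast_eq_zero_iff k p n).mp h)
  have hcard := card_singJets (k := k) m
    (by exact_mod_cast natCast_ne_zero 2 (by norm_num) (by omega))
    (by exact_mod_cast natCast_ne_zero 3 (by norm_num) hp3)
  refine ⟨hcard, ?_⟩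
  have hq : (Fintype.card k : ℝ) ≠ 0 := by exact_mod_cast Fintype.card_ne_zero
  rw [hcard]
  push_cast
  field_simp
  ring
end
end

section
/- Let q be a power of a prime p > 3, let m ≥ 1, and let e ≥ 1, k ≥ 1 be integers with e ≤ k/(6(m+1)). Let r = (r_1,…,r_m) ∈ (𝔽_{q^e})^m be a point such that 𝔽_q(r_1,…,r_m) = 𝔽_{q^e} (a closed point of degree e of the affine chart of ℙ^m). Then among all Weierstrass pairs (A,B) of level k, the fraction of pairs whose dehomogenization (a,b) admits x, y ∈ 𝔽̄_q with y² = x³ + a(r)·x + b(r), 2y = 0, 3x² + a(r) = 0, and (∂a/∂u_j)(r)·x + (∂b/∂u_j)(r) = 0 for all j = 1,…,m, is exactly q^{-(m+1)e}; that is, q^{(m+1)e} times the number of such 'bad' pairs equals the total number of Weierstrass pairs of level k. -/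
open MvPolynomial Filter

noncomputable section

variable (F : Type) [Field F] [Fintype F]

/-- Dehomogenization: substitute `x₀ = 1` and rename `x_{j+1}` to `u_j`. -/
def dehom (m : ℕ) : MvPolynomial (Fin (m + 1)) F →ₐ[F] MvPolynomial (Fin m) F :=
  aeval (Fin.cases 1 X)

/-- The set of Weierstrass pairs `(A,B)` of level `k`: `A` homogeneous of degree `4k`
and `B` homogeneous of degree `6k`. -/
def WPairs (m k : ℕ) : Set (MvPolynomial (Fin (m + 1)) F × MvPolynomial (Fin (m + 1)) F) :=
  {AB | AB.1.IsHomogeneous (4 * k) ∧ AB.2.IsHomogeneous (6 * k)}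

/-- The Weierstrass hypersurface `y² = x³ + a·x + b` (with `(a,b)` the
dehomogenization of `(A,B)`) is singular at a point lying over the affine point `r`. -/
def SingAtAff (m : ℕ) (A B : MvPolynomial (Fin (m + 1)) F)
    (r : Fin m → AlgebraicClosure F) : Prop :=
  ∃ x y : AlgebraicClosure F,
    y ^ 2 = x ^ 3 + aeval r (dehom F m A) * x + aeval r (dehom F m B) ∧
    2 * y = 0 ∧
    3 * x ^ 2 + aeval r (dehom F m A) = 0 ∧
    ∀ j, aeval r (pderiv j (dehom F m A)) * x + aeval r (pderiv j (dehom F m B)) = 0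

/-- The homogeneous forms of degree at least `dim R` surject onto a finite-dimensional algebra `R`
when the whole polynomial ring does and one of the variables maps to `1`. -/
theorem exists_isHomogeneous_of_surjective {K σ R : Type*} [Field K] [CommRing R] [Algebra K R]
    [FiniteDimensional K R] (ψ : MvPolynomial σ K →ₐ[K] R) (hψ : Function.Surjective ψ)
    (i₀ : σ) (h₀ : ψ (X i₀) = 1) (d : ℕ) (hd : Module.finrank K R ≤ d) (w : R) :
    ∃ f : MvPolynomial σ K, f.IsHomogeneous d ∧ ψ f = w := by
  let W : ℕ → Submodule K R := fun n => (homogeneousSubmodule σ K n).map ψ.toLinearMap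
  have hmul : ∀ n (i : σ) (v : R), v ∈ W n → ψ (X i) * v ∈ W (n + 1) := by
    rintro n i _ ⟨f, hf, rfl⟩
    refine ⟨X i * f, ?_, by simp⟩
    rw [add_comm]
    exact (isHomogeneous_X K i).mul hf
  have hmono : ∀ n, W n ≤ W (n + 1) := fun n v hv => by
    simpa [h₀] using hmul n i₀ v hv
  have hone : ∀ n, (1 : R) ∈ W n := fun n =>
    ⟨X i₀ ^ n, by simpa using (isHomogeneous_X K i₀).pow n, by simp [h₀]⟩
  have hstable : ∀ n, W (n + 1) = W n → W n = ⊤ := by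
    intro n hn
    refine eq_top_iff.2 fun v _ => ?_
    obtain ⟨f, rfl⟩ := hψ v
    induction f using MvPolynomial.induction_on with
    | C a =>
      have : ψ (C a) = a • (1 : R) := by
        rw [← MvPolynomial.algebraMap_eq, AlgHom.commutes, Algebra.algebraMap_eq_smul_one]
      rw [this]
      exact (W n).smul_mem a (hone n)
    | add f g hf hg =>
      rw [map_add]
      exact (W n).add_mem (hf trivial) (hg trivial)
    | mul_X f i hf =>
      rw [map_mul, mul_comm, ← hn]
      exact hmul n i _ (hf trivial)
  have hgrow : ∀ n, W n = ⊤ ∨ n ≤ Module.finrank K (W n) := by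
    intro n
    induction n with
    | zero => exact Or.inr (Nat.zero_le _)
    | succ n ih =>
      by_cases hn : W (n + 1) = W n
      · left
        rw [hn, hstable n hn]
      · right
        have hlt : W n < W (n + 1) := lt_of_le_of_ne (hmono n) (Ne.symm hn)
        rcases ih with htop | hle
        · exact absurd (htop ▸ hlt) not_top_lt
        · exact hle.trans_lt (Submodule.finrank_lt_finrank_of_lt hlt)
  have htop : W d = ⊤ := by
    rcases hgrow d with h | h
    · exact h
    · exact Submodule.eq_top_of_finrank_eq (le_antisymm (Submodule.finrank_le _) (hd.trans h))
  obtain ⟨f, hf, hfw⟩ : w ∈ W d := htop ▸ Submodule.mem_top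
  exact ⟨f, hf, hfw⟩

/-- The preimage of `S` under a surjective homomorphism has `#ker * #S` elements. -/
theorem natCard_preimage_of_surjective {V W : Type*} [AddCommGroup V] [AddCommGroup W]
    (J : V →+ W) (hJ : Function.Surjective J) (S : Set W) :
    Nat.card (J ⁻¹' S) = Nat.card J.ker * Nat.card S := by
  rw [← Nat.card_prod]
  refine Nat.card_congr
    { toFun := fun v => (⟨v.1 - Function.surjInv hJ (J v.1), ?_⟩, ⟨J v.1, v.2⟩)
      invFun := fun w => ⟨w.1.1 + Function.surjInv hJ w.2.1, ?_⟩
      left_inv := fun v => ?_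
      right_inv := fun w => ?_ }
  · simp [AddMonoidHom.mem_ker, Function.surjInv_eq hJ]
  · have h : J w.1.1 = 0 := w.1.2
    simp [h, Function.surjInv_eq hJ]
  · simp
  · have h : J w.1.1 = 0 := w.1.2
    ext <;> simp [h, Function.surjInv_eq hJ]

section Jet

variable {K L : Type*} [Field K] [Field L] [Algebra K L] {m : ℕ}

/-- The algebra of first-order jets at an `L`-rational point of affine `m`-space. -/
abbrev JetAlg (L : Type*) [Field L] (m : ℕ) : Type _ := TrivSqZeroExt L (Fin m → L)

/-- The first-order Taylor expansion at `s`. -/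
def jet (s : Fin m → L) : MvPolynomial (Fin m) K →ₐ[K] JetAlg L m :=
  aeval fun i => TrivSqZeroExt.inl (s i) + TrivSqZeroExt.inr (Pi.single i 1)

theorem fst_jet (s : Fin m → L) (f : MvPolynomial (Fin m) K) :
    (jet s f).fst = aeval s f := by
  have h : (TrivSqZeroExt.fstHom K L (Fin m → L)).comp (jet s) = aeval s := by
    ext i
    simp [jet]
  exact DFunLike.congr_fun h f

theorem snd_jet (s : Fin m → L) (f : MvPolynomial (Fin m) K) (j : Fin m) :
    (jet s f).snd j = aeval s (pderiv j f) := by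
  induction f using MvPolynomial.induction_on with
  | C a =>
    rw [← MvPolynomial.algebraMap_eq, AlgHom.commutes]
    simp [TrivSqZeroExt.algebraMap_eq_inl']
  | add f g hf hg => simp [hf, hg]
  | mul_X f i hf =>
    have hX : jet (K := K) s (X i) =
        TrivSqZeroExt.inl (s i) + TrivSqZeroExt.inr (Pi.single i 1) := by simp [jet]
    rw [map_mul, TrivSqZeroExt.snd_mul, hX]
    rcases eq_or_ne j i with rfl | hij
    · simp [hf, fst_jet, mul_comm]
    · simp [hf, fst_jet, pderiv_X_of_ne hij.symm, hij]

theorem jet_surjective [Finite L] (s : Fin m → L)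
    (hs : Function.Surjective (aeval s : MvPolynomial (Fin m) K →ₐ[K] L)) :
    Function.Surjective (jet (K := K) s) := by
  have := Fintype.ofFinite L
  have hinl : ∀ θ : L, (TrivSqZeroExt.inl θ : JetAlg L m) ∈ (jet (K := K) s).range := by
    intro θ
    obtain ⟨f, hf⟩ := hs θ
    refine ⟨f ^ Fintype.card L, ?_⟩
    change jet s (f ^ Fintype.card L) = _
    rw [map_pow]
    ext j
    · simp [fst_jet, hf, FiniteField.pow_card]
    · simp [TrivSqZeroExt.snd_pow]
  have hinr : ∀ i, (TrivSqZeroExt.inr (Pi.single i 1) : JetAlg L m) ∈ (jet (K := K) s).range := by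
    intro i
    have h : jet (K := K) s (X i) - TrivSqZeroExt.inl (s i) ∈ (jet (K := K) s).range :=
      sub_mem ⟨X i, rfl⟩ (hinl _)
    simpa [jet] using h
  intro w
  have hw : w = TrivSqZeroExt.inl w.fst +
      ∑ i, TrivSqZeroExt.inl (w.snd i) * TrivSqZeroExt.inr (Pi.single i 1) := by
    ext j
    · simp [TrivSqZeroExt.fst_sum]
    · simp [TrivSqZeroExt.snd_sum, Finset.sum_apply, Pi.single_apply]
  change w ∈ (jet (K := K) s).range
  rw [hw]
  exact add_mem (hinl _) (sum_mem fun i _ => mul_mem (hinl _) (hinr i))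

theorem finrank_jetAlg [FiniteDimensional K L] :
    Module.finrank K (JetAlg L m) = (m + 1) * Module.finrank K L := by
  have h : Module.finrank K (JetAlg L m) = Module.finrank K (L × (Fin m → L)) := rfl
  rw [h, Module.finrank_prod, Module.finrank_pi_fintype]
  simp
  ring

/-- Pairs of jets of Weierstrass coefficients for which the hypersurface has a singular point with
`L`-rational first coordinate over the base point. -/
def singJets (L : Type*) [Field L] (m : ℕ) : Set (JetAlg L m × JetAlg L m) :=
  {w | ∃ x : L, w.1.fst = -3 * x ^ 2 ∧ w.2.fst = 2 * x ^ 3 ∧ ∀ j, w.2.snd j = -(w.1.snd j * x)}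

theorem natCard_singJets (h2 : (2 : L) ≠ 0) (h3 : (3 : L) ≠ 0) :
    Nat.card (singJets L m) = Nat.card (JetAlg L m) := by
  symm
  refine Nat.card_congr (Equiv.ofBijective (fun w : JetAlg L m =>
    (⟨(TrivSqZeroExt.inl (-3 * w.fst ^ 2) + TrivSqZeroExt.inr w.snd,
      TrivSqZeroExt.inl (2 * w.fst ^ 3) + TrivSqZeroExt.inr (fun j => -(w.snd j * w.fst))),
      w.fst, by simp, by simp, by simp⟩ : singJets L m)) ⟨?_, ?_⟩)
  · intro v w h
    replace h := Prod.ext_iff.1 (congrArg Subtype.val h)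
    have hsnd : v.snd = w.snd := by simpa using congrArg TrivSqZeroExt.snd h.1
    have hsq : v.fst ^ 2 = w.fst ^ 2 := by simpa [h3] using congrArg TrivSqZeroExt.fst h.1
    have hcube : v.fst ^ 3 = w.fst ^ 3 := by simpa [h2] using congrArg TrivSqZeroExt.fst h.2
    refine TrivSqZeroExt.ext ?_ hsnd
    have hprod : v.fst ^ 2 * (v.fst - w.fst) = 0 := by
      linear_combination hcube - w.fst * hsq
    rcases mul_eq_zero.1 hprod with h0 | h0
    · rw [pow_eq_zero_iff two_ne_zero |>.1 h0,
        pow_eq_zero_iff two_ne_zero |>.1 (hsq.symm.trans h0)]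
    · exact sub_eq_zero.1 h0
  · rintro ⟨⟨a, b⟩, x, ha, hb, hab⟩
    refine ⟨TrivSqZeroExt.inl x + TrivSqZeroExt.inr a.snd, Subtype.ext (Prod.ext ?_ ?_)⟩
    · ext j <;> simp_all
    · ext j <;> simp_all

end Jet

theorem singAtAff_iff {m : ℕ} (L : IntermediateField F (AlgebraicClosure F))
    (h2 : (2 : AlgebraicClosure F) ≠ 0) (h3 : (3 : AlgebraicClosure F) ≠ 0)
    (s : Fin m → L) (A B : MvPolynomial (Fin (m + 1)) F) :
    SingAtAff F m A B (fun i => (s i : AlgebraicClosure F)) ↔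
      (jet s (dehom F m A), jet s (dehom F m B)) ∈ singJets L m := by
  have hcoe : ∀ f : MvPolynomial (Fin m) F,
      aeval (fun i => (s i : AlgebraicClosure F)) f = ((aeval s f : L) : AlgebraicClosure F) :=
    fun f => (MvPolynomial.aeval_algebraMap_apply (AlgebraicClosure F) s f)
  have c2 : ((2 : L) : AlgebraicClosure F) = 2 := rfl
  have c3 : ((3 : L) : AlgebraicClosure F) = 3 := rfl
  simp only [SingAtAff, singJets, Set.mem_ofPred_eq, fst_jet, snd_jet, hcoe]
  constructor
  · rintro ⟨x, y, hxy, hy, hx, hj⟩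
    obtain rfl : y = 0 := by simpa [h2] using hy
    set α : L := aeval s (dehom F m A)
    set β : L := aeval s (dehom F m B)
    have hα : (α : AlgebraicClosure F) = -3 * x ^ 2 := by linear_combination hx
    have hβ : (β : AlgebraicClosure F) = 2 * x ^ 3 := by linear_combination -hxy - x * hx
    have hxL : x ∈ L := by
      by_cases hx0 : x = 0
      · exact hx0 ▸ L.zero_mem
      · have hxeq : x = ((-3 * β / (2 * α) : L) : AlgebraicClosure F) := by
          push_cast
          rw [hα, hβ, c2, c3]
          field_simp
        rw [hxeq]
        exact SetLike.coe_mem _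
    refine ⟨⟨x, hxL⟩, Subtype.ext (by simpa [c3] using hα), Subtype.ext (by simpa [c2] using hβ),
      fun j => Subtype.ext ?_⟩
    push_cast
    linear_combination hj j
  · rintro ⟨x, hα, hβ, hj⟩
    refine ⟨x, 0, ?_, by simp, ?_, fun j => ?_⟩
    · rw [hα, hβ]; push_cast; rw [c2, c3]; ring
    · rw [hα]; push_cast; rw [c3]; ring
    · rw [hj j]; push_cast; ring

/-- The linear map sending a pair of forms to the pair of jets of its dehomogenization. -/
def pairJet {m : ℕ} {L : Type*} [Field L] [Algebra F L] (s : Fin m → L) (d₁ d₂ : ℕ) :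
    homogeneousSubmodule (Fin (m + 1)) F d₁ × homogeneousSubmodule (Fin (m + 1)) F d₂ →ₗ[F]
      JetAlg L m × JetAlg L m :=
  LinearMap.prodMap (((jet s).comp (dehom F m)).toLinearMap ∘ₗ Submodule.subtype _)
    (((jet s).comp (dehom F m)).toLinearMap ∘ₗ Submodule.subtype _)

theorem dehom_surjective (m : ℕ) : Function.Surjective (dehom F m) := fun f =>
  ⟨rename Fin.succ f, by
    rw [dehom, aeval_rename]
    exact aeval_X_left_apply f⟩

theorem pairJet_surjective {m : ℕ} {L : Type*} [Field L] [Algebra F L] [FiniteDimensional F L]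
    (s : Fin m → L) (hs : Function.Surjective (jet (K := F) s)) (d₁ d₂ : ℕ)
    (h₁ : (m + 1) * Module.finrank F L ≤ d₁) (h₂ : (m + 1) * Module.finrank F L ≤ d₂) :
    Function.Surjective (pairJet F s d₁ d₂) := by
  have : FiniteDimensional F (JetAlg L m) :=
    inferInstanceAs (FiniteDimensional F (L × (Fin m → L)))
  have key := exists_isHomogeneous_of_surjective ((jet s).comp (dehom F m))
    (hs.comp (dehom_surjective F m)) 0 (by simp [dehom])
  rintro ⟨v, w⟩
  obtain ⟨f, hf, hfv⟩ := key d₁ (finrank_jetAlg.trans_le h₁) v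
  obtain ⟨g, hg, hgw⟩ := key d₂ (finrank_jetAlg.trans_le h₂) w
  exact ⟨(⟨f, hf⟩, ⟨g, hg⟩), Prod.ext hfv hgw⟩

/-- for a closed point `r` of degree `e ≤ k/(6(m+1))` of the affine
chart of `ℙ^m`, the fraction of Weierstrass pairs of level `k` whose model is
singular over `r` is exactly `q^{-(m+1)e}`; that is, `q^{(m+1)e}` times the number
of bad pairs equals the total number of pairs of level `k`. -/
theorem stmt8 (p : ℕ) (hp : p.Prime) (hp3 : 3 < p) [CharP F p]
    (m : ℕ) (hm : 1 ≤ m) (e k : ℕ) (he : 1 ≤ e) (hk : 1 ≤ k)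
    (hek : 6 * (m + 1) * e ≤ k)
    (r : Fin m → AlgebraicClosure F)
    (hr : Module.finrank F (IntermediateField.adjoin F (Set.range r)) = e) :
    Fintype.card F ^ ((m + 1) * e) *
        Nat.card {AB ∈ WPairs F m k | SingAtAff F m AB.1 AB.2 r} =
      Nat.card (WPairs F m k) := by
  set L := IntermediateField.adjoin F (Set.range r) with hL
  have : FiniteDimensional F L := Module.finite_of_finrank_pos (by omega)
  have : Finite L := Module.finite_of_finite F
  have : CharP L p := charP_of_injective_algebraMap (algebraMap F L).injective p
  have : CharP (AlgebraicClosure F) p :=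
    charP_of_injective_algebraMap (algebraMap F (AlgebraicClosure F)).injective p
  have hne : ∀ (M : Type) [Field M] [CharP M p] (n : ℕ), 0 < n → n < p → (n : M) ≠ 0 :=
    fun M _ _ n hn hnp h => Nat.not_dvd_of_pos_of_lt hn hnp ((CharP.cast_eq_zero_iff M p n).1 h)
  let s : Fin m → L := fun i => ⟨r i, IntermediateField.subset_adjoin F _ ⟨i, rfl⟩⟩
  have hs : Function.Surjective (aeval s : MvPolynomial (Fin m) F →ₐ[F] L) := by
    rintro ⟨x, hx⟩
    have hx' : x ∈ Algebra.adjoin F (Set.range r) := by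
      rw [← IntermediateField.adjoin_toSubalgebra]
      exact hx
    rw [Algebra.adjoin_range_eq_range_aeval] at hx'
    obtain ⟨f, hf⟩ := hx'
    refine ⟨f, Subtype.ext ?_⟩
    exact (MvPolynomial.aeval_algebraMap_apply (AlgebraicClosure F) s f).symm.trans hf
  have hsize : (m + 1) * Module.finrank F L ≤ k := by
    rw [hr]
    nlinarith [Nat.zero_le ((m + 1) * e)]
  let J := (pairJet F s (4 * k) (6 * k)).toAddMonoidHom
  have hJ : Function.Surjective J :=
    pairJet_surjective F s (jet_surjective s hs) _ _ (by omega) (by omega)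
  let E : (homogeneousSubmodule (Fin (m + 1)) F (4 * k) ×
      homogeneousSubmodule (Fin (m + 1)) F (6 * k)) ≃ WPairs F m k :=
    { toFun := fun P => ⟨(P.1.1, P.2.1), P.1.2, P.2.2⟩
      invFun := fun P => (⟨P.1.1, P.2.1⟩, ⟨P.1.2, P.2.2⟩)
      left_inv := fun _ => rfl
      right_inv := fun _ => rfl }
  have hmem : ∀ P, J P ∈ singJets L m ↔ SingAtAff F m (E P).1.1 (E P).1.2 r := fun P =>
    (singAtAff_iff F L (mod_cast hne _ 2 (by omega) (by omega))
      (mod_cast hne _ 3 (by omega) (by omega)) s P.1.1 P.2.1).symm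
  have hbad : Nat.card {AB ∈ WPairs F m k | SingAtAff F m AB.1 AB.2 r} =
      Nat.card (J ⁻¹' singJets L m) :=
    Nat.card_congr (((E.subtypeEquiv hmem).trans
      (Equiv.subtypeSubtypeEquivSubtypeInter (· ∈ WPairs F m k)
        (fun AB => SingAtAff F m AB.1 AB.2 r))).symm)
  have hall : Nat.card (WPairs F m k) = Nat.card (J ⁻¹' Set.univ) :=
    Nat.card_congr (E.symm.trans (Equiv.Set.univ _).symm)
  have hcard : Nat.card (JetAlg L m) = Fintype.card F ^ ((m + 1) * e) := by
    have : FiniteDimensional F (JetAlg L m) :=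
      inferInstanceAs (FiniteDimensional F (L × (Fin m → L)))
    rw [Module.natCard_eq_pow_finrank (K := F), finrank_jetAlg, hr, Nat.card_eq_fintype_card]
  rw [hbad, hall, natCard_preimage_of_surjective J hJ, natCard_preimage_of_surjective J hJ,
    natCard_singJets (mod_cast hne _ 2 (by omega) (by omega))
      (mod_cast hne _ 3 (by omega) (by omega)), Nat.card_congr (Equiv.Set.univ _),
    Nat.card_prod, hcard]
  ring
end
end

section
/- Let q be a power of a prime p > 3 and let m ≥ 1. For k ≥ 1 let f(k) be the fraction of Weierstrass pairs (A,B) of level k for which there exists a point P ∈ ℙ^m(𝔽̄_q) of degree at least k/(6(m+1)) such that W_{A,B} is singular over P. Then limsup_{k→∞} f(k) = 0. -/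
open MvPolynomial Filter

noncomputable section

variable (F : Type) [Field F] [Fintype F]

/-- The Weierstrass model `W_{A,B}` is singular at a point lying over the point of
`ℙ^m(𝔽̄_q)` with homogeneous coordinates `pt`. -/
def SingAt (m : ℕ) (A B : MvPolynomial (Fin (m + 1)) F)
    (pt : Fin (m + 1) → AlgebraicClosure F) : Prop :=
  ∃ x y : AlgebraicClosure F,
    y ^ 2 = x ^ 3 + aeval pt A * x + aeval pt B ∧
    2 * y = 0 ∧
    3 * x ^ 2 + aeval pt A = 0 ∧
    ∀ i, aeval pt (pderiv i A) * x + aeval pt (pderiv i B) = 0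

/-- The degree of the point of `ℙ^m(𝔽̄_q)` with homogeneous coordinates `pt`,
computed using the nonzero coordinate `pt j`: the degree over `𝔽_q` of the field
generated by the ratios `pt i / pt j`. -/
def degPt (m : ℕ) (pt : Fin (m + 1) → AlgebraicClosure F) (j : Fin (m + 1)) : ℕ :=
  Module.finrank F (IntermediateField.adjoin F (Set.range fun i => pt i / pt j))

/-- For `n` polynomials in `n` variables and one more variable `X l`, an algebraic relation of
explicitly bounded degree, by comparison of dimensions. -/
theorem exists_relation {F : Type} [Field F] {n D : ℕ} (hD : 1 ≤ D)
    (f : Fin n → MvPolynomial (Fin n) F) (hf : ∀ i s, degreeOf s (f i) ≤ D) (l : Fin n) :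
    ∃ Q : MvPolynomial (Fin n) (Polynomial F), Q ≠ 0 ∧
      (∀ i, degreeOf i Q ≤ ((n + 1) * D) ^ n) ∧
      (∀ α, (coeff α Q).natDegree ≤ ((n + 1) * D) ^ n) ∧
      eval₂ (Polynomial.aeval (R := F) (X l : MvPolynomial (Fin n) F)).toRingHom f Q = 0 := by
  classical
  set N := ((n + 1) * D) ^ n with hN
  set M := (n + 1) * D * N with hM
  let e : ∀ K : ℕ, (Fin n → Fin (K + 1)) → (Fin n →₀ ℕ) :=
    fun K β => Finsupp.equivFunOnFinite.symm fun i => (β i : ℕ)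
  have he : ∀ K, Function.Injective (e K) := by
    intro K a b h
    have := Finsupp.equivFunOnFinite.symm.injective h
    funext i
    exact Fin.ext (congrFun this i)
  let v : (Fin n → Fin (N + 1)) × Fin (N + 1) → MvPolynomial (Fin n) F :=
    fun a => X l ^ (a.2 : ℕ) * ∏ i, f i ^ (a.1 i : ℕ)
  have hv : ∀ a s, degreeOf s (v a) ≤ M := by
    intro a s
    refine (degreeOf_mul_le _ _ _).trans ?_
    have h1 : degreeOf s (X l ^ (a.2 : ℕ) : MvPolynomial (Fin n) F) ≤ N * D := by
      refine (degreeOf_pow_le _ _ _).trans ?_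
      refine Nat.mul_le_mul (Nat.lt_succ_iff.mp a.2.2) ?_
      rw [degreeOf_X]; split_ifs <;> omega
    have h2 : degreeOf s (∏ i, f i ^ (a.1 i : ℕ)) ≤ n * (N * D) := by
      refine (degreeOf_prod_le _ _ _).trans ?_
      refine (Finset.sum_le_card_nsmul _ _ (N * D) ?_).trans (by simp)
      intro i _
      refine (degreeOf_pow_le _ _ _).trans ?_
      exact Nat.mul_le_mul (Nat.lt_succ_iff.mp (a.1 i).2) (hf i s)
    calc _ ≤ N * D + n * (N * D) := add_le_add h1 h2
      _ = M := by rw [hM]; ring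
  let P := Fintype.linearCombination F v
  let coef : MvPolynomial (Fin n) F →ₗ[F] ((Fin n → Fin (M + 1)) → F) :=
    LinearMap.pi fun β => lcoeff F (e M β)
  have hdeg : ∀ a s, degreeOf s (P a) ≤ M := by
    intro a s
    simp only [P, Fintype.linearCombination_apply]
    refine (degreeOf_sum_le _ _ _).trans (Finset.sup_le fun b _ => ?_)
    rw [smul_eq_C_mul]
    exact (degreeOf_C_mul_le _ _ _).trans (hv _ _)
  have hker : LinearMap.ker (coef ∘ₗ P) ≠ ⊥ := by
    apply LinearMap.ker_ne_bot_of_finrank_lt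
    simp only [Module.finrank_fintype_fun_eq_card, Fintype.card_prod, Fintype.card_pi,
      Fintype.card_fin, Finset.prod_const, Finset.card_univ]
    have : M + 1 ≤ (n + 1) * D * (N + 1) := by
      have : 1 ≤ (n + 1) * D := Nat.mul_pos (by omega) hD
      rw [mul_add, mul_one]; omega
    calc (M + 1) ^ n ≤ ((n + 1) * D * (N + 1)) ^ n := Nat.pow_le_pow_left this n
      _ = (N + 1) ^ n * N := by rw [mul_pow, ← hN, mul_comm]
      _ < (N + 1) ^ n * (N + 1) := by
        apply Nat.mul_lt_mul_of_pos_left (by omega) (by positivity)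
  obtain ⟨a, ha, ha0⟩ := (Submodule.ne_bot_iff _).mp hker
  have hPa : P a = 0 := by
    ext β
    rw [coeff_zero]
    by_contra hc
    have hβ : ∀ i, β i ≤ M := fun i =>
      (monomial_le_degreeOf i (mem_support_iff.mpr hc)).trans (hdeg a i)
    have := congrFun (LinearMap.mem_ker.mp ha) fun i => ⟨β i, Nat.lt_succ_of_le (hβ i)⟩
    have hβ' : e M (fun i => ⟨β i, Nat.lt_succ_of_le (hβ i)⟩) = β := by
      ext i
      simp [e]
    apply hc
    rw [← hβ']
    exact this
  let r : (Fin n → Fin (N + 1)) → Polynomial F :=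
    fun α => ∑ s : Fin (N + 1), Polynomial.monomial (s : ℕ) (a (α, s))
  let Q : MvPolynomial (Fin n) (Polynomial F) := ∑ α, monomial (e N α) (r α)
  have hQ : ∀ α, coeff (e N α) Q = r α := by
    intro α
    simp only [Q, coeff_sum, coeff_monomial, (he N).eq_iff]
    simp
  have hQ' : ∀ β, coeff β Q ≠ 0 → ∃ α, e N α = β := by
    intro β h
    by_contra! hne
    apply h
    simp only [Q, coeff_sum, coeff_monomial]
    exact Finset.sum_eq_zero fun α _ => if_neg (hne α)
  have hr : ∀ α, (r α).natDegree ≤ N := fun α =>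
    Polynomial.natDegree_sum_le_of_forall_le _ _ fun s _ =>
      (Polynomial.natDegree_monomial_le _).trans (Nat.lt_succ_iff.mp s.2)
  refine ⟨Q, ?_, ?_, ?_, ?_⟩
  · intro h0
    apply ha0
    funext ⟨α, s⟩
    have := hQ α
    rw [h0, coeff_zero] at this
    have := congrArg (fun u => Polynomial.coeff u s) this
    simp only [r, Polynomial.finsetSum_coeff, Polynomial.coeff_monomial, Fin.val_inj] at this
    simpa using this.symm
  · intro i
    rw [degreeOf_le_iff]
    intro β hβ
    obtain ⟨α, rfl⟩ := hQ' β (mem_support_iff.mp hβ)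
    exact Nat.lt_succ_iff.mp (α i).2
  · intro β
    by_cases h : coeff β Q = 0
    · simp [h]
    · obtain ⟨α, rfl⟩ := hQ' β h
      rw [hQ]; exact hr α
  · rw [← hPa]
    simp only [Q, eval₂_sum, eval₂_monomial, P, Fintype.linearCombination_apply,
      Fintype.sum_prod_type, r, map_sum, v]
    refine Finset.sum_congr rfl fun α _ => Finset.sum_congr rfl fun s _ => ?_
    rw [Finsupp.prod_fintype _ _ (fun i => pow_zero _)]
    simp [e, Polynomial.aeval_monomial, smul_eq_C_mul, MvPolynomial.algebraMap_eq, mul_assoc]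

theorem natDegree_eval_le {F : Type} [Field F] {n N e : ℕ} (Q : MvPolynomial (Fin n) (Polynomial F))
    (h1 : ∀ i, degreeOf i Q ≤ N) (h2 : ∀ α, (coeff α Q).natDegree ≤ N)
    (c : Fin n → Polynomial F) (hc : ∀ i, (c i).natDegree ≤ e) :
    (eval c Q).natDegree ≤ N + n * (N * e) := by
  rw [eval_eq']
  refine Polynomial.natDegree_sum_le_of_forall_le _ _ fun α hα => ?_
  refine Polynomial.natDegree_mul_le.trans (add_le_add (h2 α) ?_)
  refine (Polynomial.natDegree_prod_le _ _).trans ?_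
  refine (Finset.sum_le_card_nsmul _ _ (N * e) fun i _ => ?_).trans (by simp)
  refine Polynomial.natDegree_pow_le.trans (Nat.mul_le_mul ?_ (hc i))
  exact (monomial_le_degreeOf i hα).trans (h1 i)

/-- The univariate polynomial with prescribed coefficients. -/
def toPoly {F : Type} [Field F] {d : ℕ} (c : Fin (d + 1) → F) : Polynomial F :=
  ∑ s : Fin (d + 1), Polynomial.monomial (s : ℕ) (c s)

theorem toPoly_injective {F : Type} [Field F] {d : ℕ} :
    Function.Injective (toPoly (F := F) (d := d)) := by
  intro a b h
  funext s
  have := congrArg (fun u => Polynomial.coeff u s) h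
  simpa only [toPoly, Polynomial.finsetSum_coeff, Polynomial.coeff_monomial, Fin.val_inj,
    Finset.sum_ite_eq', Finset.sum_ite_eq, Finset.mem_univ, if_true] using this

theorem natDegree_toPoly_le {F : Type} [Field F] {d : ℕ} (c : Fin (d + 1) → F) :
    (toPoly c).natDegree ≤ d :=
  Polynomial.natDegree_sum_le_of_forall_le _ _ fun s _ =>
    (Polynomial.natDegree_monomial_le _).trans (Nat.lt_succ_iff.mp s.2)

theorem card_eval_neg_pow_eq_zero_le {F : Type} [Field F] [Fintype F] {p : ℕ} (hp : p.Prime) [CharP F p]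
    {n N d : ℕ} (Q : MvPolynomial (Fin n) (Polynomial F)) (hQ : Q ≠ 0)
    (h1 : ∀ i, degreeOf i Q ≤ N) :
    (Nat.card {c : Fin n → Fin (d + 1) → F | eval (fun i => -(toPoly (c i)) ^ p) Q = 0} : ℝ)
      ≤ n * N / (Fintype.card F : ℝ) ^ (d + 1) * Nat.card (Fin n → Fin (d + 1) → F) := by
  classical
  have : Fact p.Prime := ⟨hp⟩
  let g : (Fin (d + 1) → F) → Polynomial F := fun c => -(toPoly c) ^ p
  have hg : Function.Injective g := fun a b h =>
    toPoly_injective (frobenius_inj (Polynomial F) p (neg_injective h))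
  let S : Finset (Polynomial F) := Finset.univ.image g
  have hS : S.card = Fintype.card F ^ (d + 1) := by
    rw [Finset.card_image_of_injective _ hg]; simp
  have hsz := schwartz_zippel_sum_degreeOf hQ (fun _ => S)
  set T := {x ∈ Fintype.piFinset (fun _ : Fin n => S) | eval x Q = 0} with hT
  have hle : Nat.card {c : Fin n → Fin (d + 1) → F | eval (fun i => -(toPoly (c i)) ^ p) Q = 0}
      ≤ T.card := by
    rw [Nat.card_eq_fintype_card, ← Set.toFinset_card]
    refine Finset.card_le_card_of_injOn (fun c i => g (c i)) ?_ ?_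
    · intro c hc
      simp only [Set.coe_toFinset, Set.mem_ofPred_eq] at hc
      simp only [hT, Finset.coe_filter, Fintype.mem_piFinset, Set.mem_ofPred_eq]
      exact ⟨fun i => Finset.mem_image_of_mem _ (Finset.mem_univ _), hc⟩
    · intro a _ b _ h
      funext i
      exact hg (congrFun h i)
  have hq : 0 < (Fintype.card F : ℝ) := by exact_mod_cast Fintype.card_pos
  have hszR : (T.card : ℝ) / ((Fintype.card F : ℝ) ^ (d + 1)) ^ n ≤
      ∑ i : Fin n, (degreeOf i Q : ℝ) / (Fintype.card F : ℝ) ^ (d + 1) := by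
    have := (NNRat.cast_le (K := ℝ)).mpr hsz
    push_cast at this
    simpa [hS] using this
  have h3 : ∑ i : Fin n, (degreeOf i Q : ℝ) / (Fintype.card F : ℝ) ^ (d + 1) ≤
      n * N / (Fintype.card F : ℝ) ^ (d + 1) := by
    refine (Finset.sum_le_card_nsmul _ _ ((N : ℝ) / (Fintype.card F : ℝ) ^ (d + 1)) ?_).trans ?_
    · intro i _
      have : (degreeOf i Q : ℝ) ≤ N := by exact_mod_cast h1 i
      gcongr
    · simp [mul_div_assoc]
  have hcard : (Nat.card (Fin n → Fin (d + 1) → F) : ℝ) = ((Fintype.card F : ℝ) ^ (d + 1)) ^ n := by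
    simp
  rw [hcard, ← div_le_iff₀ (by positivity)]
  refine le_trans ?_ (hszR.trans h3)
  gcongr

instance finite_homogeneousSubmodule {F σ : Type} [Field F] [Finite σ] (d : ℕ) :
    Module.Finite F (homogeneousSubmodule σ F d) :=
  Module.Finite.iff_fg.mpr (homogeneousSubmodule_fg σ F d)

theorem min_le_finrank_map_aeval {F K σ : Type} [Field F] [Finite σ] [Field K] [Algebra F K]
    [Algebra.IsAlgebraic F K] (pt : σ → K) (j : σ) (hj : pt j = 1) (d : ℕ) :
    min (d + 1) (Module.finrank F (IntermediateField.adjoin F (Set.range pt))) ≤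
      Module.finrank F ((homogeneousSubmodule σ F d).map (aeval (R := F) pt).toLinearMap) := by
  let W : ℕ → Submodule F K := fun d =>
    (homogeneousSubmodule σ F d).map (aeval (R := F) pt).toLinearMap
  have hfin : ∀ d, Module.Finite F (W d) := fun d => Module.Finite.map _ _
  have hone : ∀ d, (1 : K) ∈ W d := fun d =>
    ⟨X j ^ d, isHomogeneous_X_pow j d, by simp [hj]⟩
  have hmul : ∀ d i w, w ∈ W d → pt i * w ∈ W (d + 1) := by
    rintro d i _ ⟨P, hP, rfl⟩
    refine ⟨X i * P, ?_, by simp⟩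
    have := (isHomogeneous_X F i).mul hP
    rwa [add_comm] at this
  have hmono : ∀ d, W d ≤ W (d + 1) := fun d w hw => by
    simpa [hj] using hmul d j w hw
  have hstable : ∀ d, W d = W (d + 1) →
      Module.finrank F (IntermediateField.adjoin F (Set.range pt)) ≤ Module.finrank F (W d) := by
    intro d hd
    have hsub : ∀ x ∈ Algebra.adjoin F (Set.range pt), ∀ w ∈ W d, x * w ∈ W d := by
      intro x hx
      induction hx using Algebra.adjoin_induction with
      | mem x hx =>
        obtain ⟨i, rfl⟩ := hx
        intro w hw
        rw [hd]
        exact hmul d i w hw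
      | algebraMap r =>
        intro w hw
        rw [← Algebra.smul_def]
        exact (W d).smul_mem r hw
      | add x y _ _ hx hy =>
        intro w hw
        rw [add_mul]
        exact (W d).add_mem (hx w hw) (hy w hw)
      | mul x y _ _ hx hy =>
        intro w hw
        rw [mul_assoc]
        exact hx _ (hy w hw)
    have hle : (IntermediateField.adjoin F (Set.range pt)).toSubalgebra.toSubmodule ≤ W d := by
      intro x hx
      rw [IntermediateField.adjoin_toSubalgebra_of_isAlgebraic
        (fun x _ => Algebra.IsAlgebraic.isAlgebraic x)] at hx
      simpa using hsub x hx 1 (hone d)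
    have := hfin d
    exact Submodule.finrank_mono hle
  change min (d + 1) _ ≤ Module.finrank F (W d)
  induction d with
  | zero =>
    refine (min_le_left _ _).trans ?_
    have := hfin 0
    have : 0 < Module.finrank F (W 0) := by
      rw [Module.finrank_pos_iff_exists_ne_zero]
      exact ⟨⟨1, hone 0⟩, fun h => one_ne_zero (congrArg Subtype.val h)⟩
    omega
  | succ d ih =>
    have := hfin (d + 1)
    rcases (hmono d).eq_or_lt with h | h
    · rw [← h]
      exact (min_le_right _ _).trans (hstable d h)
    · have := Submodule.finrank_lt_finrank_of_lt h
      omega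

theorem card_fiber_pow_le {F K σ : Type} [Field F] [Fintype F] [Finite σ] [Field K] [Algebra F K]
    {p : ℕ} (hp : p.Prime) [CharP K p] (pt : σ → K) (d r : ℕ)
    (hr : r ≤ Module.finrank F ((homogeneousSubmodule σ F d).map (aeval (R := F) pt).toLinearMap))
    (v : K) :
    (Nat.card {h : homogeneousSubmodule σ F d | (aeval pt (h : MvPolynomial σ F)) ^ p = v} : ℝ) ≤
      Nat.card (homogeneousSubmodule σ F d) / (Fintype.card F : ℝ) ^ r := by
  have : Fact p.Prime := ⟨hp⟩
  let H := homogeneousSubmodule σ F d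
  have : Finite H := Module.finite_of_finite F
  let φ : H →ₗ[F] K := (aeval (R := F) pt).toLinearMap.domRestrict H
  have hrange : LinearMap.range φ = H.map (aeval (R := F) pt).toLinearMap :=
    LinearMap.range_domRestrict _ _
  have hcard : Nat.card H = Nat.card (LinearMap.ker φ) *
      Nat.card F ^ Module.finrank F (H.map (aeval (R := F) pt).toLinearMap) := by
    rw [← hrange, Module.natCard_eq_pow_finrank (K := F) (V := H),
      Module.natCard_eq_pow_finrank (K := F) (V := LinearMap.ker φ), ← pow_add,
      ← LinearMap.finrank_range_add_finrank_ker φ, add_comm]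
  have hq : (1 : ℝ) ≤ Fintype.card F := by exact_mod_cast Fintype.card_pos
  have hfib : Nat.card {h : H | (aeval pt (h : MvPolynomial σ F)) ^ p = v} ≤
      Nat.card (LinearMap.ker φ) := by
    by_cases hne : ∃ h₀ : H, (aeval pt (h₀ : MvPolynomial σ F)) ^ p = v
    · obtain ⟨h₀, hh₀⟩ := hne
      refine Nat.card_le_card_of_injective
        (fun h : {h : H | (aeval pt (h : MvPolynomial σ F)) ^ p = v} =>
          (⟨h.1 - h₀, ?_⟩ : LinearMap.ker φ)) ?_
      · rw [LinearMap.mem_ker, map_sub, sub_eq_zero]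
        exact frobenius_inj K p (h.2.trans hh₀.symm)
      · intro a b hab
        exact Subtype.ext (sub_left_injective (congrArg Subtype.val hab))
    · have : IsEmpty {h : H | (aeval pt (h : MvPolynomial σ F)) ^ p = v} :=
        ⟨fun h => hne ⟨h.1, h.2⟩⟩
      simp
  rw [le_div_iff₀ (by positivity)]
  change _ ≤ (Nat.card H : ℝ)
  rw [hcard, Nat.card_eq_fintype_card (α := F)]
  push_cast
  have hfib' : (Nat.card {h : H | (aeval pt (h : MvPolynomial σ F)) ^ p = v} : ℝ) ≤
      Nat.card (LinearMap.ker φ) := by exact_mod_cast hfib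
  exact mul_le_mul hfib' (pow_le_pow_right₀ hq hr) (by positivity) (by positivity)

/-- If, for every point of a finite group, at most a proportion `a` of its translates by a family
of elements lie in `E`, then `E` has density at most `a`. -/
theorem card_le_of_translates {G C : Type} [AddCommGroup G] [Finite C] [Nonempty C]
    (W : AddSubgroup G) [Finite W] (φ : C → G) (hφ : ∀ c, φ c ∈ W) (E : Set G) (hE : E ⊆ W) (a : ℝ)
    (h : ∀ w ∈ W, (Nat.card {c | w + φ c ∈ E} : ℝ) ≤ a * Nat.card C) :
    (Nat.card E : ℝ) ≤ a * Nat.card W := by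
  classical
  have := Fintype.ofFinite C
  have := Fintype.ofFinite W
  have hC : (0 : ℝ) < Nat.card C := by exact_mod_cast Nat.card_pos
  have key : ∀ c, Nat.card E = Nat.card {w : W | (w : G) + φ c ∈ E} := by
    intro c
    refine Nat.card_congr ⟨fun e => ⟨⟨e.1 - φ c, W.sub_mem (hE e.2) (hφ c)⟩, ?_⟩,
      fun w => ⟨w.1.1 + φ c, w.2⟩, ?_, ?_⟩
    · simp
    · intro e; simp
    · intro w; simp
  have hsum : Nat.card C * Nat.card E = ∑ w : W, Nat.card {c | (w : G) + φ c ∈ E} := by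
    calc Nat.card C * Nat.card E = ∑ c : C, Nat.card {w : W | (w : G) + φ c ∈ E} := by
          rw [Finset.sum_congr rfl fun c _ => (key c).symm]; simp
      _ = ∑ c : C, ∑ w : W, if (w : G) + φ c ∈ E then 1 else 0 := by
          refine Finset.sum_congr rfl fun c _ => ?_
          rw [Nat.card_eq_fintype_card, Fintype.card_subtype, Finset.card_filter]; rfl
      _ = ∑ w : W, ∑ c : C, if (w : G) + φ c ∈ E then 1 else 0 := Finset.sum_comm
      _ = _ := by
          refine Finset.sum_congr rfl fun w _ => ?_
          rw [Nat.card_eq_fintype_card, Fintype.card_subtype, Finset.card_filter]; rfl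
  have : (Nat.card C : ℝ) * Nat.card E ≤ Nat.card C * (a * Nat.card W) := by
    have h2 : (Nat.card C : ℝ) * Nat.card E =
        ∑ w : W, (Nat.card {c | (w : G) + φ c ∈ E} : ℝ) := by exact_mod_cast hsum
    rw [h2]
    refine (Finset.sum_le_card_nsmul _ _ _ fun (w : W) _ => h w.1 w.2).trans (le_of_eq ?_)
    rw [nsmul_eq_mul, Finset.card_univ, ← Nat.card_eq_fintype_card]
    ring
  exact le_of_mul_le_mul_left this hC

theorem card_le_of_cover {α ι : Type} (T : Finset ι) (S : Set α) (V : ι → Set α)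
    (hV : ∀ t, (V t).Finite) (hS : ∀ s ∈ S, ∃ t ∈ T, s ∈ V t) (b : ℝ)
    (hb : ∀ t ∈ T, (Nat.card (V t) : ℝ) ≤ b) : (Nat.card S : ℝ) ≤ T.card * b := by
  have h1 : Nat.card S ≤ ∑ t ∈ T, Nat.card (V t) := by
    refine le_trans ?_ (Finset.set_ncard_biUnion_le T V)
    refine Set.ncard_le_ncard (fun s hs => ?_) (T.finite_toSet.biUnion fun t _ => hV t)
    obtain ⟨t, ht, hst⟩ := hS s hs
    exact Set.mem_biUnion (Finset.mem_coe.mpr ht) hst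
  calc (Nat.card S : ℝ) ≤ ∑ t ∈ T, (Nat.card (V t) : ℝ) := by exact_mod_cast h1
    _ ≤ T.card • b := Finset.sum_le_card_nsmul _ _ _ hb
    _ = T.card * b := nsmul_eq_mul _ _

theorem pderiv_pow_char_mul {R σ : Type} [CommRing R] {p : ℕ} [CharP R p] (i : σ)
    (g h : MvPolynomial σ R) : pderiv i (g ^ p * h) = g ^ p * pderiv i h := by
  rw [Derivation.leibniz, Derivation.leibniz_pow]
  simp [← Nat.cast_smul_eq_nsmul (MvPolynomial σ R)]

section

variable {E : Type} [Field E]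

/-- Vanishing at `(pt, x)` of the partial derivatives of `x ^ 3 + A x + B`, leaving out the
derivative along the `j`-th coordinate. -/
def Crit {m : ℕ} (j : Fin (m + 1)) (A B : MvPolynomial (Fin (m + 1)) E)
    (pt : Fin (m + 1) → AlgebraicClosure E) (x : AlgebraicClosure E) : Prop :=
  3 * x ^ 2 + aeval pt A = 0 ∧
    ∀ i, i ≠ j → aeval pt (pderiv i A) * x + aeval pt (pderiv i B) = 0

/-- The `l`-th coordinates of the critical points in the chart `pt j = 1` are roots of a nonzero
polynomial of degree at most `N`. -/
def Controlled {m : ℕ} (j l : Fin (m + 1)) (N : ℕ)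
    (AB : MvPolynomial (Fin (m + 1)) E × MvPolynomial (Fin (m + 1)) E) : Prop :=
  ∃ u : Polynomial E, u ≠ 0 ∧ u.natDegree ≤ N ∧
    ∀ pt x, pt j = 1 → Crit j AB.1 AB.2 pt x → Polynomial.aeval (pt l) u = 0

/-- Substituting `1` for the `j`-th variable. -/
def dehomogenize {m : ℕ} (j : Fin (m + 1)) :
    MvPolynomial (Fin (m + 1)) E →ₐ[E] MvPolynomial (Fin (m + 1)) E :=
  aeval fun i => if i = j then 1 else X i

theorem degreeOf_dehomogenize_le {m : ℕ} (j s : Fin (m + 1)) {n : ℕ}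
    {P : MvPolynomial (Fin (m + 1)) E} (hP : P.IsHomogeneous n) :
    degreeOf s (dehomogenize j P) ≤ n := by
  rw [dehomogenize, aeval_def, eval₂_eq']
  refine (degreeOf_sum_le _ _ _).trans (Finset.sup_le fun α hα => ?_)
  refine (degreeOf_C_mul_le _ _ _).trans ?_
  refine (degreeOf_prod_le _ _ _).trans ?_
  have : α.degree = n := by
    by_contra h
    exact (mem_support_iff.mp hα) (hP.coeff_eq_zero h)
  rw [← this, Finsupp.degree_eq_sum]
  refine Finset.sum_le_sum fun i _ => (degreeOf_pow_le _ _ _).trans ?_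
  refine (Nat.mul_le_mul_left _ (?_ : _ ≤ 1)).trans (mul_one _).le
  split_ifs
  · simp
  · rw [degreeOf_X]; split_ifs <;> simp

theorem aeval_update_dehomogenize {m : ℕ} {K : Type} [Field K] [Algebra E K] (j : Fin (m + 1))
    (pt : Fin (m + 1) → K) (hj : pt j = 1) (x : K) (P : MvPolynomial (Fin (m + 1)) E) :
    aeval (Function.update pt j x) (dehomogenize j P) = aeval pt P := by
  have : (aeval (R := E) (Function.update pt j x)).comp (dehomogenize j) = aeval pt := by
    ext i
    by_cases h : i = j
    · subst h; simp [dehomogenize, hj]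
    · simp [dehomogenize, h]
  exact DFunLike.congr_fun this P

/-- Homogenization by means of `X j` of the univariate polynomial in `X l` with prescribed
coefficients. -/
def homPoly {m d : ℕ} (j l : Fin (m + 1)) (c : Fin (d + 1) → E) : MvPolynomial (Fin (m + 1)) E :=
  ∑ s : Fin (d + 1), C (c s) * (X l ^ (s : ℕ) * X j ^ (d - s))

theorem isHomogeneous_homPoly {m d : ℕ} (j l : Fin (m + 1)) (c : Fin (d + 1) → E) :
    (homPoly j l c).IsHomogeneous d := by
  refine IsHomogeneous.sum _ _ _ fun s _ => IsHomogeneous.C_mul ?_ _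
  have := (isHomogeneous_X_pow (R := E) l (s : ℕ)).mul (isHomogeneous_X_pow (R := E) j (d - s))
  rwa [Nat.add_sub_of_le (Nat.lt_succ_iff.mp s.2)] at this

theorem aeval_homPoly {m d : ℕ} {K : Type} [Field K] [Algebra E K] (j l : Fin (m + 1))
    (c : Fin (d + 1) → E) (pt : Fin (m + 1) → K) (hj : pt j = 1) :
    aeval pt (homPoly j l c) = Polynomial.aeval (pt l) (toPoly c) := by
  simp [homPoly, toPoly, hj, Polynomial.aeval_monomial]

/-- The perturbation of a Weierstrass pair that changes the partial derivatives independently by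
`p`-th powers of univariate polynomials in the `l`-th coordinate. -/
def perturb {m d : ℕ} (p k : ℕ) (j l : Fin (m + 1)) (c : Fin (m + 1) → Fin (d + 1) → E) :
    MvPolynomial (Fin (m + 1)) E × MvPolynomial (Fin (m + 1)) E :=
  (homPoly j l (c j) ^ p * X j ^ (4 * k - d * p),
    ∑ i ∈ Finset.univ.erase j, homPoly j l (c i) ^ p * (X i * X j ^ (6 * k - 1 - d * p)))

theorem perturb_mem {m d p k : ℕ} (hk : 1 ≤ k) (hd : d * p ≤ 4 * k) (j l : Fin (m + 1))
    (c : Fin (m + 1) → Fin (d + 1) → E) : perturb p k j l c ∈ WPairs E m k := by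
  constructor
  · have := ((isHomogeneous_homPoly j l (c j)).pow p).mul
      (isHomogeneous_X_pow (R := E) j (4 * k - d * p))
    rwa [Nat.add_sub_of_le hd] at this
  · refine IsHomogeneous.sum _ _ _ fun i _ => ?_
    have := ((isHomogeneous_homPoly j l (c i)).pow p).mul
      ((isHomogeneous_X E i).mul (isHomogeneous_X_pow (R := E) j (6 * k - 1 - d * p)))
    convert this using 1
    omega

theorem crit_add_perturb {m d p k : ℕ} [CharP E p] {j l : Fin (m + 1)}
    {A B : MvPolynomial (Fin (m + 1)) E} (c : Fin (m + 1) → Fin (d + 1) → E)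
    {pt : Fin (m + 1) → AlgebraicClosure E} (hj : pt j = 1) {x : AlgebraicClosure E}
    (h : Crit j (A + (perturb p k j l c).1) (B + (perturb p k j l c).2) pt x) :
    3 * x ^ 2 + aeval pt A = -(Polynomial.aeval (pt l) (toPoly (c j))) ^ p ∧
      ∀ i, i ≠ j → aeval pt (pderiv i A) * x + aeval pt (pderiv i B) =
        -(Polynomial.aeval (pt l) (toPoly (c i))) ^ p := by
  obtain ⟨h1, h2⟩ := h
  constructor
  · simp only [perturb, map_add, map_mul, map_pow, aeval_homPoly j l _ pt hj, aeval_X, hj,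
      one_pow, mul_one] at h1
    linear_combination h1
  · intro i hi
    have h3 := h2 i hi
    have hA : pderiv i (perturb p k j l c).1 = 0 := by
      simp only [perturb, pderiv_pow_char_mul, Derivation.leibniz_pow, pderiv_X_of_ne hi.symm]
      simp
    have hB : pderiv i (perturb p k j l c).2 =
        homPoly j l (c i) ^ p * X j ^ (6 * k - 1 - d * p) := by
      simp only [perturb, map_sum, pderiv_pow_char_mul]
      rw [Finset.sum_eq_single i]
      · simp [Derivation.leibniz, Derivation.leibniz_pow, pderiv_X_of_ne hi.symm]
      · intro i' _ hne
        simp [Derivation.leibniz, Derivation.leibniz_pow, pderiv_X_of_ne hi.symm,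
          pderiv_X_of_ne hne]
      · intro hni
        exact absurd (Finset.mem_erase.mpr ⟨hi, Finset.mem_univ _⟩) hni
    simp only [map_add, hA, hB, map_mul, map_pow, aeval_homPoly j l _ pt hj, aeval_X, hj,
      one_pow, mul_one, add_zero] at h3
    linear_combination h3

/-- Degree bound for an algebraic relation among the partial derivatives. -/
def relDegree (m k : ℕ) : ℕ := ((m + 1 + 1) * (6 * k)) ^ (m + 1)

/-- Bound for the number of values of a coordinate at critical points. -/
def coordBound (m k : ℕ) : ℕ := relDegree m k + (m + 1) * (relDegree m k * (4 * k))

theorem exists_relation_partials {m k : ℕ} (hk : 1 ≤ k) {j l : Fin (m + 1)} (hl : l ≠ j)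
    {AB : MvPolynomial (Fin (m + 1)) E × MvPolynomial (Fin (m + 1)) E} (h : AB ∈ WPairs E m k)
    {p d : ℕ} [CharP E p] (hd : d * p ≤ 4 * k) :
    ∃ Q : MvPolynomial (Fin (m + 1)) (Polynomial E), Q ≠ 0 ∧
      (∀ i, degreeOf i Q ≤ relDegree m k) ∧
      ∀ c : Fin (m + 1) → Fin (d + 1) → E, eval (fun i => -(toPoly (c i)) ^ p) Q ≠ 0 →
        Controlled j l (coordBound m k) (AB + perturb p k j l c) := by
  obtain ⟨A, B⟩ := AB
  obtain ⟨hA, hB⟩ := h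
  simp only at hA hB
  let f : Fin (m + 1) → MvPolynomial (Fin (m + 1)) E := fun i =>
    if i = j then C 3 * X j ^ 2 + dehomogenize j A
    else dehomogenize j (pderiv i A) * X j + dehomogenize j (pderiv i B)
  have hX : ∀ s, degreeOf s (X j : MvPolynomial (Fin (m + 1)) E) ≤ 1 := by
    intro s; rw [degreeOf_X]; split_ifs <;> simp
  have hf : ∀ i s, degreeOf s (f i) ≤ 6 * k := by
    intro i s
    simp only [f]
    split_ifs with hi
    · refine (degreeOf_add_le _ _ _).trans (max_le ?_ ?_)
      · refine (degreeOf_C_mul_le _ _ _).trans ((degreeOf_pow_le _ _ _).trans ?_)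
        have := hX s
        omega
      · exact (degreeOf_dehomogenize_le j s hA).trans (by omega)
    · refine (degreeOf_add_le _ _ _).trans (max_le ?_ ?_)
      · have h1 := degreeOf_mul_le s (dehomogenize j (pderiv i A)) (X j)
        have h2 := degreeOf_dehomogenize_le j s (hA.pderiv (i := i))
        have h3 := hX s
        omega
      · exact (degreeOf_dehomogenize_le j s hB.pderiv).trans (by omega)
  obtain ⟨Q, hQ, hQ1, hQ2, hQ3⟩ := exists_relation (by omega) f hf l
  refine ⟨Q, hQ, hQ1, fun c hc => ⟨_, hc, ?_, ?_⟩⟩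
  · refine (natDegree_eval_le Q hQ1 hQ2 _ (e := 4 * k) fun i => ?_).trans le_rfl
    rw [Polynomial.natDegree_neg]
    refine Polynomial.natDegree_pow_le.trans (le_trans ?_ hd)
    rw [mul_comm]
    exact Nat.mul_le_mul_right _ (natDegree_toPoly_le _)
  · intro pt x hj hcrit
    obtain ⟨h1, h2⟩ := crit_add_perturb c hj hcrit
    let z := Function.update pt j x
    have hz : ∀ i, aeval z (f i) =
        Polynomial.aeval (pt l) (-(toPoly (c i)) ^ p : Polynomial E) := by
      intro i
      simp only [f]
      split_ifs with hi
      · subst hi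
        rw [map_neg, map_pow, ← h1]
        simp only [map_add, map_mul, map_pow, aeval_X, z, Function.update_self,
          aeval_update_dehomogenize i pt hj, map_ofNat]
      · rw [map_neg, map_pow, ← h2 i hi]
        simp [z, aeval_update_dehomogenize j pt hj]
    have h4 := congrArg (aeval (R := E) z).toRingHom hQ3
    rw [eval₂_comp_left, map_zero] at h4
    rw [eval, coe_eval₂Hom, ← AlgHom.coe_toRingHom, eval₂_comp_left, ← h4]
    congr 1
    · ext a
      · simp
      · simp [z, hl]
    · funext i
      exact (hz i).symm

/-- The Weierstrass pairs of level `k` as an additive group. -/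
def weierstrassGroup (E : Type) [Field E] (m k : ℕ) :
    AddSubgroup (MvPolynomial (Fin (m + 1)) E × MvPolynomial (Fin (m + 1)) E) :=
  ((homogeneousSubmodule (Fin (m + 1)) E (4 * k)).prod
    (homogeneousSubmodule (Fin (m + 1)) E (6 * k))).toAddSubgroup

theorem mem_weierstrassGroup {m k : ℕ}
    {AB : MvPolynomial (Fin (m + 1)) E × MvPolynomial (Fin (m + 1)) E} :
    AB ∈ weierstrassGroup E m k ↔ AB ∈ WPairs E m k := Iff.rfl

theorem finite_WPairs [Fintype E] (m k : ℕ) : (WPairs E m k).Finite := by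
  have (d : ℕ) : Finite (homogeneousSubmodule (Fin (m + 1)) E d) := Module.finite_of_finite E
  exact (Set.toFinite (homogeneousSubmodule (Fin (m + 1)) E (4 * k) :
      Set (MvPolynomial (Fin (m + 1)) E))).prod
    (Set.toFinite (homogeneousSubmodule (Fin (m + 1)) E (6 * k) :
      Set (MvPolynomial (Fin (m + 1)) E)))

instance finite_weierstrassGroup [Fintype E] (m k : ℕ) : Finite (weierstrassGroup E m k) :=
  (finite_WPairs m k).to_subtype

theorem card_not_controlled_le [Fintype E] {p : ℕ} (hp : p.Prime) [CharP E p] {m k d : ℕ}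
    (hk : 1 ≤ k) (hd : d * p ≤ 4 * k) {j l : Fin (m + 1)} (hl : l ≠ j) :
    (Nat.card {AB | AB ∈ WPairs E m k ∧ ¬ Controlled j l (coordBound m k) AB} : ℝ) ≤
      (m + 1) * relDegree m k / (Fintype.card E : ℝ) ^ (d + 1) * Nat.card (WPairs E m k) := by
  refine card_le_of_translates (weierstrassGroup E m k) (perturb (d := d) p k j l)
    (fun c => perturb_mem hk hd j l c) _ (fun _ h => h.1) _ fun w hw => ?_
  obtain ⟨Q, hQ, hQ1, hQ2⟩ := exists_relation_partials hk hl (mem_weierstrassGroup.mp hw) hd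
    (p := p) (d := d)
  have := card_eval_neg_pow_eq_zero_le hp (d := d) Q hQ hQ1
  push_cast at this
  refine le_trans ?_ this
  rw [Nat.cast_le]
  refine Nat.card_mono (Set.toFinite _) fun c hc => ?_
  by_contra h
  exact hc.2 (hQ2 c h)

theorem crit_add_pow {m p a : ℕ} [CharP E p] {j : Fin (m + 1)}
    (A B h : MvPolynomial (Fin (m + 1)) E) (pt : Fin (m + 1) → AlgebraicClosure E)
    (x : AlgebraicClosure E) :
    Crit j A (B + h ^ p * X j ^ a) pt x ↔ Crit j A B pt x := by
  refine and_congr Iff.rfl (forall₂_congr fun i hi => ?_)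
  have : pderiv i (h ^ p * X j ^ a) = 0 := by
    rw [pderiv_pow_char_mul]
    simp [Derivation.leibniz_pow, pderiv_X_of_ne hi.symm]
  rw [map_add, this, add_zero]

/-- Weierstrass pairs with controlled critical points that are singular over a point of the chart
`pt j = 1` of degree at least `k / (6 (m + 1))`. -/
def highDegreeSingular (E : Type) [Field E] (m k : ℕ) (j : Fin (m + 1)) :
    Set (MvPolynomial (Fin (m + 1)) E × MvPolynomial (Fin (m + 1)) E) :=
  {AB | AB ∈ WPairs E m k ∧ (∀ l, l ≠ j → Controlled j l (coordBound m k) AB) ∧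
    ∃ (pt : Fin (m + 1) → AlgebraicClosure E) (x : AlgebraicClosure E), pt j = 1 ∧
      k ≤ 6 * (m + 1) * Module.finrank E (IntermediateField.adjoin E (Set.range pt)) ∧
      Crit j AB.1 AB.2 pt x ∧ x ^ 3 + aeval pt AB.1 * x + aeval pt AB.2 = 0}

theorem card_highDegreeSingular_le [Fintype E] {p : ℕ} (hp : p.Prime) (hp3 : 3 < p) [CharP E p]
    {m k d r : ℕ} (hk : 1 ≤ k) (hd : d * p ≤ 4 * k) (hrd : r ≤ d + 1)
    (hrk : r ≤ k / (6 * (m + 1))) (j : Fin (m + 1)) :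
    (Nat.card (highDegreeSingular E m k j) : ℝ) ≤
      ((coordBound m k ^ (m + 1) * 2 : ℕ) : ℝ) / (Fintype.card E : ℝ) ^ r *
        Nat.card (WPairs E m k) := by
  classical
  let K := AlgebraicClosure E
  have : CharP K p := charP_of_injective_algebraMap (algebraMap E K).injective p
  have h3 : (3 : K) ≠ 0 := by
    intro h
    have h' : ((3 : ℕ) : K) = 0 := by exact_mod_cast h
    exact absurd (Nat.le_of_dvd (by norm_num) ((CharP.cast_eq_zero_iff K p 3).mp h')) (by omega)
  have hN : 1 ≤ coordBound m k := by
    have : 1 ≤ relDegree m k := Nat.pow_pos (Nat.mul_pos (by omega) (by omega))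
    rw [coordBound]; omega
  let H := homogeneousSubmodule (Fin (m + 1)) E d
  have : Finite H := Module.finite_of_finite E
  let a := 6 * k - d * p
  let φ : H → MvPolynomial (Fin (m + 1)) E × MvPolynomial (Fin (m + 1)) E :=
    fun h => (0, (h : MvPolynomial (Fin (m + 1)) E) ^ p * X j ^ a)
  have hφ : ∀ h, φ h ∈ weierstrassGroup E m k := by
    intro h
    refine ⟨isHomogeneous_zero _ _ _, ?_⟩
    have h1 : (h : MvPolynomial (Fin (m + 1)) E).IsHomogeneous d := h.2
    have := (h1.pow p).mul (isHomogeneous_X_pow (R := E) j a)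
    rwa [Nat.add_sub_of_le (by omega)] at this
  refine card_le_of_translates (weierstrassGroup E m k) φ hφ _ (fun _ h => h.1) _ fun w hw => ?_
  by_cases hcon : ∀ l, l ≠ j → Controlled j l (coordBound m k) w
  swap
  · have : IsEmpty {h | w + φ h ∈ highDegreeSingular E m k j} := by
      refine ⟨fun ⟨h, hh⟩ => hcon fun l hl => ?_⟩
      obtain ⟨u, hu, hu1, hu2⟩ := hh.2.1 l hl
      refine ⟨u, hu, hu1, fun pt x hj hc => hu2 pt x hj ?_⟩
      simpa [φ] using (crit_add_pow (p := p) (a := a) w.1 w.2 h pt x).mpr hc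
    rw [Nat.card_of_isEmpty, Nat.cast_zero]
    positivity
  choose u hu hu1 hu2 using hcon
  let S : Fin (m + 1) → Finset K := fun l =>
    if hl : l = j then {1} else ((u l hl).map (algebraMap E K)).roots.toFinset
  have hS : ∀ l, (S l).card ≤ coordBound m k := by
    intro l
    by_cases hl : l = j
    · simp only [S, hl, dite_true, Finset.card_singleton]; exact hN
    · simp only [S, hl, dite_false]
      refine (Multiset.toFinset_card_le _).trans ((Polynomial.card_roots' _).trans ?_)
      exact Polynomial.natDegree_map_le.trans (hu1 l hl)
  let T : Finset (Σ _ : Fin (m + 1) → K, K) :=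
    ((Fintype.piFinset S).filter fun pt =>
      k ≤ 6 * (m + 1) * Module.finrank E (IntermediateField.adjoin E (Set.range pt)) ∧
        pt j = 1).sigma
      fun pt => (Polynomial.C (3 : K) * Polynomial.X ^ 2 +
        Polynomial.C (aeval pt w.1)).roots.toFinset
  have hquad : ∀ b : K, Polynomial.C (3 : K) * Polynomial.X ^ 2 + Polynomial.C b ≠ 0 := by
    intro b h
    have := congrArg (fun P => Polynomial.coeff P 2) h
    simp at this
    exact h3 this
  have hT : T.card ≤ coordBound m k ^ (m + 1) * 2 := by
    rw [Finset.card_sigma]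
    refine (Finset.sum_le_card_nsmul _ _ 2 fun pt _ => ?_).trans ?_
    · refine (Multiset.toFinset_card_le _).trans ((Polynomial.card_roots' _).trans ?_)
      compute_degree
    · rw [smul_eq_mul]
      refine Nat.mul_le_mul_right _ ((Finset.card_filter_le _ _).trans ?_)
      rw [Fintype.card_piFinset]
      exact (Finset.prod_le_pow_card _ _ _ fun l _ => hS l).trans (by simp)
  have hcover := card_le_of_cover T {h : H | w + φ h ∈ highDegreeSingular E m k j}
    (fun t => {h : H | (aeval t.1 (h : MvPolynomial (Fin (m + 1)) E)) ^ p =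
      -(t.2 ^ 3 + aeval t.1 w.1 * t.2 + aeval t.1 w.2)})
    (fun _ => Set.toFinite _) ?_ (Nat.card H / (Fintype.card E : ℝ) ^ r) ?_
  · refine hcover.trans ?_
    have hT' : (T.card : ℝ) ≤ ((coordBound m k ^ (m + 1) * 2 : ℕ) : ℝ) := by exact_mod_cast hT
    calc _ ≤ ((coordBound m k ^ (m + 1) * 2 : ℕ) : ℝ) *
          (Nat.card H / (Fintype.card E : ℝ) ^ r) := by gcongr
      _ = _ := by ring
  · rintro h ⟨-, -, pt, x, hj, hdeg, hc, hx⟩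
    simp only [φ, Prod.fst_add, Prod.snd_add, add_zero] at hc hx
    rw [crit_add_pow] at hc
    refine ⟨⟨pt, x⟩, ?_, ?_⟩
    · simp only [T, Finset.mem_sigma, Finset.mem_filter, Fintype.mem_piFinset]
      refine ⟨⟨fun l => ?_, hdeg, hj⟩, ?_⟩
      · by_cases hl : l = j
        · simp [S, hl, hj]
        · simp only [S, hl, dite_false, Multiset.mem_toFinset]
          rw [Polynomial.mem_roots_map (hu l hl)]
          exact hu2 l hl pt x hj hc
      · rw [Multiset.mem_toFinset, Polynomial.mem_roots (hquad _)]
        rw [Polynomial.IsRoot.def]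
        simp only [Polynomial.eval_add, Polynomial.eval_mul, Polynomial.eval_pow,
          Polynomial.eval_C, Polynomial.eval_X]
        exact hc.1
    · simp only [Set.mem_ofPred_eq]
      simp only [map_add, map_mul, map_pow, aeval_X, hj, one_pow, mul_one] at hx
      linear_combination hx
  · rintro ⟨pt, x⟩ ht
    simp only [T, Finset.mem_sigma, Finset.mem_filter] at ht
    refine card_fiber_pow_le hp pt d r (le_trans (le_min hrd ?_)
      (min_le_finrank_map_aeval pt j ht.1.2.2 d)) _
    exact hrk.trans (Nat.div_le_of_le_mul ht.1.2.1)

theorem aeval_mul_of_isHomogeneous {K σ : Type} [Fintype σ] [Field K] [Algebra E K] {n : ℕ}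
    {P : MvPolynomial σ E} (hP : P.IsHomogeneous n) (t : K) (pt : σ → K) :
    aeval (fun i => t * pt i) P = t ^ n * aeval pt P := by
  rw [aeval_def, aeval_def, eval₂_eq', eval₂_eq', Finset.mul_sum]
  refine Finset.sum_congr rfl fun α hα => ?_
  have : α.degree = n := by
    by_contra h
    exact (mem_support_iff.mp hα) (hP.coeff_eq_zero h)
  simp only [mul_pow, Finset.prod_mul_distrib, Finset.prod_pow_eq_pow_sum]
  rw [← Finsupp.degree_eq_sum, this]
  ring

theorem exists_crit_of_singAt {m k : ℕ} (hk : 1 ≤ k) (h2 : (2 : AlgebraicClosure E) ≠ 0)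
    {A B : MvPolynomial (Fin (m + 1)) E} (hA : A.IsHomogeneous (4 * k))
    (hB : B.IsHomogeneous (6 * k)) {pt : Fin (m + 1) → AlgebraicClosure E}
    (h : SingAt E m A B pt) (j : Fin (m + 1)) :
    ∃ x, Crit j A B (fun i => pt i / pt j) x ∧
      x ^ 3 + aeval (fun i => pt i / pt j) A * x + aeval (fun i => pt i / pt j) B = 0 := by
  obtain ⟨x, y, hxy, hy, hx, hd⟩ := h
  have hy0 : y = 0 := (mul_eq_zero.mp hy).resolve_left h2
  subst hy0
  set t := (pt j)⁻¹ with ht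
  have hpt : (fun i => pt i / pt j) = fun i => t * pt i := by
    funext i
    rw [div_eq_mul_inv, mul_comm]
  rw [hpt]
  obtain ⟨k, rfl⟩ := Nat.exists_eq_add_of_le' hk
  refine ⟨t ^ (2 * (k + 1)) * x, ⟨?_, fun i _ => ?_⟩, ?_⟩
  · rw [aeval_mul_of_isHomogeneous hA]
    linear_combination t ^ (4 * (k + 1)) * hx
  · rw [aeval_mul_of_isHomogeneous hA.pderiv, aeval_mul_of_isHomogeneous hB.pderiv]
    have h4 : 4 * (k + 1) - 1 = 4 * k + 3 := by omega
    have h6 : 6 * (k + 1) - 1 = 6 * k + 5 := by omega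
    rw [h4, h6]
    linear_combination t ^ (6 * k + 5) * hd i
  · rw [aeval_mul_of_isHomogeneous hA, aeval_mul_of_isHomogeneous hB]
    linear_combination -t ^ (6 * (k + 1)) * hxy

theorem tendsto_pow_div_two_pow_div (a : ℕ) {M : ℕ} (hM : M ≠ 0) :
    Tendsto (fun k : ℕ => (k : ℝ) ^ a / 2 ^ (k / M)) atTop (nhds 0) := by
  have h1 : Tendsto (fun n : ℕ => ((n : ℝ)) ^ a / 2 ^ n) atTop (nhds 0) :=
    tendsto_pow_const_div_const_pow_of_one_lt a (by norm_num)
  have h2 : Tendsto (fun k : ℕ => k / M + 1) atTop atTop :=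
    (tendsto_add_atTop_nat 1).comp (Nat.tendsto_div_const_atTop hM)
  have h3 := ((h1.comp h2).const_mul (2 * (M : ℝ) ^ a))
  rw [mul_zero] at h3
  refine squeeze_zero (fun k => by positivity) (fun k => ?_) h3
  have hk : (k : ℝ) ≤ M * ((k / M + 1 : ℕ) : ℝ) := by
    have : k ≤ M * (k / M + 1) := (Nat.lt_mul_div_succ k (Nat.pos_of_ne_zero hM)).le
    exact_mod_cast this
  calc (k : ℝ) ^ a / 2 ^ (k / M) ≤ (M * ((k / M + 1 : ℕ) : ℝ)) ^ a / 2 ^ (k / M) := by gcongr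
    _ = _ := by
      simp only [Function.comp_apply]
      rw [mul_pow, pow_succ]
      field_simp

theorem tendsto_bound (m : ℕ) {M : ℕ} (hM : M ≠ 0) :
    Tendsto (fun k : ℕ => (((m + 1 : ℕ) : ℝ) ^ 3 * relDegree m k +
      (m + 1 : ℕ) * (coordBound m k ^ (m + 1) * 2 : ℕ)) / 2 ^ (k / M)) atTop (nhds 0) := by
  set c := (m + 1 + 1) * 6 with hc
  have h1 := (tendsto_pow_div_two_pow_div (m + 1) hM).const_mul
    (((m + 1 : ℕ) : ℝ) ^ 3 * (c : ℝ) ^ (m + 1))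
  have h2 := (tendsto_pow_div_two_pow_div ((m + 2) * (m + 1)) hM).const_mul
    (((m + 1) * ((c ^ (m + 1) * (5 * (m + 1))) ^ (m + 1) * 2) : ℕ) : ℝ)
  have h3 := h1.add h2
  rw [mul_zero, mul_zero, add_zero] at h3
  refine squeeze_zero' (Eventually.of_forall fun k => by positivity) ?_ h3
  filter_upwards [eventually_ge_atTop 1] with k hk
  have hrel : relDegree m k = c ^ (m + 1) * k ^ (m + 1) := by
    rw [relDegree, hc, ← mul_pow]; ring
  have hcoord : coordBound m k ≤ c ^ (m + 1) * (5 * (m + 1)) * k ^ (m + 2) := by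
    have : 1 + (m + 1) * (4 * k) ≤ 5 * (m + 1) * k := by nlinarith
    calc coordBound m k = c ^ (m + 1) * k ^ (m + 1) * (1 + (m + 1) * (4 * k)) := by
          rw [coordBound, hrel]; ring
      _ ≤ c ^ (m + 1) * k ^ (m + 1) * (5 * (m + 1) * k) := Nat.mul_le_mul_left _ this
      _ = _ := by ring
  have hpow : (m + 1) * (coordBound m k ^ (m + 1) * 2) ≤
      (m + 1) * ((c ^ (m + 1) * (5 * (m + 1))) ^ (m + 1) * 2) * k ^ ((m + 2) * (m + 1)) := by
    calc _ ≤ (m + 1) * ((c ^ (m + 1) * (5 * (m + 1)) * k ^ (m + 2)) ^ (m + 1) * 2) := by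
          gcongr
      _ = _ := by rw [mul_pow _ (k ^ (m + 2)), ← pow_mul]; ring
  have hpow' : ((m + 1 : ℕ) : ℝ) * (coordBound m k ^ (m + 1) * 2 : ℕ) ≤
      (((m + 1) * ((c ^ (m + 1) * (5 * (m + 1))) ^ (m + 1) * 2) : ℕ) : ℝ) *
        (k : ℝ) ^ ((m + 2) * (m + 1)) := by exact_mod_cast hpow
  rw [mul_div_assoc', mul_div_assoc', ← add_div]
  have hrel' : ((m + 1 : ℕ) : ℝ) ^ 3 * relDegree m k =
      ((m + 1 : ℕ) : ℝ) ^ 3 * (c : ℝ) ^ (m + 1) * (k : ℝ) ^ (m + 1) := by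
    rw [hrel]
    push_cast
    ring
  rw [hrel']
  gcongr

theorem card_singular_le [Fintype E] {p : ℕ} (hp : p.Prime) (hp3 : 3 < p) [CharP E p] {m k : ℕ}
    (hk : 1 ≤ k) :
    (Nat.card {AB ∈ WPairs E m k | ∃ (pt : Fin (m + 1) → AlgebraicClosure E)
        (_ : pt ≠ 0) (j : Fin (m + 1)), pt j ≠ 0 ∧
        k ≤ 6 * (m + 1) * degPt E m pt j ∧ SingAt E m AB.1 AB.2 pt} : ℝ) ≤
      (((m + 1 : ℕ) : ℝ) ^ 3 * relDegree m k + (m + 1 : ℕ) * (coordBound m k ^ (m + 1) * 2 : ℕ)) /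
        2 ^ (k / (6 * (m + 1) * p)) * Nat.card (WPairs E m k) := by
  classical
  set d := 4 * k / p with hdd
  set r := k / (6 * (m + 1) * p) with hr
  have hp0 : 0 < p := hp.pos
  have hd : d * p ≤ 4 * k := Nat.div_mul_le_self _ _
  have hrd : r ≤ d + 1 := by
    have h1 : r ≤ k / p := Nat.div_le_div_left (Nat.le_mul_of_pos_left p (by positivity)) hp0
    have h2 : k / p ≤ d := Nat.div_le_div_right (by omega)
    omega
  have hrk : r ≤ k / (6 * (m + 1)) :=
    Nat.div_le_div_left (Nat.le_mul_of_pos_right _ hp0) (by positivity)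
  have h2 : (2 : AlgebraicClosure E) ≠ 0 := by
    have : CharP (AlgebraicClosure E) p :=
      charP_of_injective_algebraMap (algebraMap E (AlgebraicClosure E)).injective p
    intro h
    have h' : ((2 : ℕ) : AlgebraicClosure E) = 0 := by exact_mod_cast h
    exact absurd (Nat.le_of_dvd (by norm_num)
      ((CharP.cast_eq_zero_iff (AlgebraicClosure E) p 2).mp h')) (by omega)
  have hfin : (WPairs E m k).Finite := finite_WPairs m k
  have hq : (2 : ℝ) ≤ Fintype.card E := by exact_mod_cast Fintype.one_lt_card
  set w : ℝ := (Nat.card (WPairs E m k) : ℝ)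
  set R : ℝ := (relDegree m k : ℝ)
  set S : ℝ := ((coordBound m k ^ (m + 1) * 2 : ℕ) : ℝ)
  have huncontrolled : ∀ j : Fin (m + 1), (Nat.card {AB | AB ∈ WPairs E m k ∧
      ¬ ∀ l, l ≠ j → Controlled j l (coordBound m k) AB} : ℝ) ≤
      (m + 1 : ℕ) * ((m + 1 : ℕ) * R / 2 ^ r * w) := by
    intro j
    have := card_le_of_cover (Finset.univ.erase j)
      {AB | AB ∈ WPairs E m k ∧ ¬ ∀ l, l ≠ j → Controlled j l (coordBound m k) AB}
      (fun l => {AB | AB ∈ WPairs E m k ∧ l ≠ j ∧ ¬ Controlled j l (coordBound m k) AB})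
      (fun l => hfin.subset fun _ h => h.1) ?_ ((m + 1 : ℕ) * R / 2 ^ r * w) ?_
    · refine this.trans ?_
      have hcard : (Finset.univ.erase j).card ≤ m + 1 :=
        (Finset.card_le_univ _).trans (by simp)
      have : ((Finset.univ.erase j).card : ℝ) ≤ (m + 1 : ℕ) := by exact_mod_cast hcard
      gcongr
    · rintro AB ⟨hAB, hn⟩
      push Not at hn
      obtain ⟨l, hl, hn⟩ := hn
      exact ⟨l, Finset.mem_erase.mpr ⟨hl, Finset.mem_univ _⟩, hAB, hl, hn⟩
    · intro l hl
      have hl' := Finset.ne_of_mem_erase hl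
      have h := card_not_controlled_le (E := E) hp hk hd hl'
      simp only [hl', ne_eq, not_false_eq_true, true_and]
      refine h.trans ?_
      push_cast
      have : (2 : ℝ) ^ r ≤ (Fintype.card E : ℝ) ^ (d + 1) :=
        (pow_le_pow_right₀ (by norm_num) hrd).trans (by gcongr)
      gcongr
  have hhigh : ∀ j : Fin (m + 1), (Nat.card (highDegreeSingular E m k j) : ℝ) ≤
      S / 2 ^ r * w := by
    intro j
    refine (card_highDegreeSingular_le hp hp3 hk hd hrd hrk j).trans ?_
    gcongr
  have htot := card_le_of_cover (Finset.univ : Finset (Fin (m + 1)))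
    {AB ∈ WPairs E m k | ∃ (pt : Fin (m + 1) → AlgebraicClosure E)
      (_ : pt ≠ 0) (j : Fin (m + 1)), pt j ≠ 0 ∧
      k ≤ 6 * (m + 1) * degPt E m pt j ∧ SingAt E m AB.1 AB.2 pt}
    (fun j => {AB | AB ∈ WPairs E m k ∧ ¬ ∀ l, l ≠ j → Controlled j l (coordBound m k) AB} ∪
      highDegreeSingular E m k j)
    (fun j => hfin.subset (Set.union_subset (fun _ h => h.1) fun _ h => h.1)) ?_
    ((m + 1 : ℕ) * ((m + 1 : ℕ) * R / 2 ^ r * w) + S / 2 ^ r * w) ?_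
  · refine htot.trans (le_of_eq ?_)
    rw [Finset.card_univ, Fintype.card_fin]
    ring
  · rintro AB ⟨hAB, pt, -, j, hj, hdeg, hsing⟩
    refine ⟨j, Finset.mem_univ _, ?_⟩
    by_cases hcon : ∀ l, l ≠ j → Controlled j l (coordBound m k) AB
    · obtain ⟨x, hx, hx'⟩ := exists_crit_of_singAt hk h2 hAB.1 hAB.2 hsing j
      exact Or.inr ⟨hAB, hcon, _, x, div_self hj, hdeg, hx, hx'⟩
    · exact Or.inl ⟨hAB, hcon⟩
  · intro j _
    refine le_trans ?_ (add_le_add (huncontrolled j) (hhigh j))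
    exact_mod_cast Set.ncard_union_le _ _

end

/-- the fraction of Weierstrass pairs of level `k` whose model is
singular over some point of `ℙ^m(𝔽̄_q)` of degree at least `k/(6(m+1))` has
limsup `0` as `k → ∞`. -/
theorem stmt10 (p : ℕ) (hp : p.Prime) (hp3 : 3 < p) [CharP F p] (m : ℕ) (hm : 1 ≤ m) :
    atTop.limsup (fun k : ℕ =>
        (Nat.card {AB ∈ WPairs F m k | ∃ (pt : Fin (m + 1) → AlgebraicClosure F)
            (_ : pt ≠ 0) (j : Fin (m + 1)), pt j ≠ 0 ∧
            k ≤ 6 * (m + 1) * degPt F m pt j ∧ SingAt F m AB.1 AB.2 pt} : ℝ) /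
          (Nat.card (WPairs F m k) : ℝ)) = 0 := by
  refine Tendsto.limsup_eq (squeeze_zero' (Eventually.of_forall fun k => by positivity) ?_
    (tendsto_bound m (M := 6 * (m + 1) * p) (by have := hp.pos; positivity)))
  filter_upwards [eventually_ge_atTop 1] with k hk
  exact div_le_of_le_mul₀ (by positivity) (by positivity) (card_singular_le hp hp3 hk)
end
end

section
/- Let q be a power of a prime p > 3 and let m ≥ 1. For integers r ≥ 1 and k ≥ 1 let g_r(k) be the fraction of Weierstrass pairs (A,B) of level k for which there exists a point P ∈ ℙ^m(𝔽̄_q) whose degree e satisfies r ≤ e ≤ k/(6(m+1)) and such that W_{A,B} is singular over P. Then lim_{r→∞} limsup_{k→∞} g_r(k) = 0; equivalently, for every ε > 0 there is r₀ such that for all r ≥ r₀ one has limsup_{k→∞} g_r(k) ≤ ε. -/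
open MvPolynomial Filter

noncomputable section

variable (F : Type) [Field F] [Fintype F]

/-- The fraction `g_r(k)` of Weierstrass pairs of level `k` whose model is singular
over some point of `ℙ^m(𝔽̄_q)` of degree `e` with `r ≤ e ≤ k/(6(m+1))`. -/
def gfrac (m r k : ℕ) : ℝ :=
  (Nat.card {AB ∈ WPairs F m k | ∃ (pt : Fin (m + 1) → AlgebraicClosure F)
      (_ : pt ≠ 0) (j : Fin (m + 1)), pt j ≠ 0 ∧
      r ≤ degPt F m pt j ∧ 6 * (m + 1) * degPt F m pt j ≤ k ∧
      SingAt F m AB.1 AB.2 pt} : ℝ) /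
    (Nat.card (WPairs F m k) : ℝ)


theorem Submodule.pow_eq_pow_of_finrank_le {K R : Type*} [Field K] [CommRing R] [Algebra K R]
    [Module.Finite K R] {M : Submodule K R} (hM : 1 ≤ M) {d n : ℕ}
    (hd : Module.finrank K R ≤ d) (hdn : d ≤ n) : M ^ n = M ^ d := by
  have hle (i : ℕ) : M ^ i ≤ M ^ (i + 1) := by
    rw [pow_succ]
    exact le_mul_of_one_le_right' hM
  have key (i : ℕ) : i ≤ Module.finrank K ↥(M ^ i) ∨ M ^ (i + 1) = M ^ i := by
    induction i with
    | zero => simp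
    | succ i ih =>
      by_cases h : M ^ (i + 1) = M ^ i
      · right
        rw [pow_succ M (i + 1), h, ← pow_succ, h]
      · left
        have h1 := ih.resolve_right h
        have h2 := Submodule.finrank_lt_finrank_of_lt (lt_of_le_of_ne (hle i) (Ne.symm h))
        omega
  have stable : M ^ (d + 1) = M ^ d := by
    rcases key d with h | h
    · have htop : M ^ d = ⊤ := Submodule.eq_top_of_finrank_eq
        (le_antisymm (Submodule.finrank_le _) (hd.trans h))
      exact le_antisymm (htop ▸ le_top) (hle d)
    · exact h
  induction n, hdn using Nat.le_induction with
  | base => rfl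
  | succ n _ ih => rw [pow_succ, ih, ← pow_succ, stable]

theorem MvPolynomial.exists_isHomogeneous_aeval_eq {σ K R : Type*} [Field K] [CommRing R]
    [Algebra K R] [Module.Finite K R] (u : σ → R) {j : σ} (hj : u j = 1) {d : ℕ}
    (hd : Module.finrank K R ≤ d) (f : MvPolynomial σ K) :
    ∃ g : MvPolynomial σ K, g.IsHomogeneous d ∧ aeval u g = aeval u f := by
  set M : Submodule K R := (homogeneousSubmodule σ K 1).map (aeval u).toLinearMap with hM
  have hpow (n : ℕ) : M ^ n = (homogeneousSubmodule σ K n).map (aeval u).toLinearMap := by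
    rw [hM, ← Submodule.map_pow, homogeneousSubmodule_one_pow]
  have h1 : 1 ≤ M := by
    rw [Submodule.one_le]
    exact ⟨X j, isHomogeneous_X K j, by simpa using hj⟩
  have hmem : aeval u f ∈ M ^ (d + f.totalDegree) := by
    have hsum := congrArg (aeval u) (sum_homogeneousComponent f)
    rw [map_sum] at hsum
    rw [← hsum]
    refine Submodule.sum_mem _ fun i hi => ?_
    have hi' : i ≤ d + f.totalDegree := by
      have := Finset.mem_range.1 hi
      omega
    refine pow_le_pow_right₀ h1 hi' ?_
    rw [hpow]
    exact ⟨_, homogeneousComponent_isHomogeneous i f, rfl⟩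
  rw [Submodule.pow_eq_pow_of_finrank_le h1 hd (Nat.le_add_right _ _), hpow] at hmem
  obtain ⟨g, hg, hgf⟩ := hmem
  exact ⟨g, hg, hgf⟩

section FirstOrderJet

variable {σ K κ : Type*} [Field K] [Field κ] [Algebra K κ] [DecidableEq σ]

/-- The point `x + ε` with values in `κ[ε]/(ε)²`, where `ε` has one coordinate for each
index other than `j`. -/
def jetPoint (x : σ → κ) (j : σ) (i : σ) : TrivSqZeroExt κ ({l : σ // l ≠ j} → κ) :=
  TrivSqZeroExt.inl (x i) + TrivSqZeroExt.inr (fun l => if l.1 = i then 1 else 0)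

theorem jetPoint_self (x : σ → κ) {j : σ} (hj : x j = 1) : jetPoint x j j = 1 := by
  have : (fun l : {l : σ // l ≠ j} => if l.1 = j then (1 : κ) else 0) = 0 := by
    ext l
    simp [l.2]
  simp [jetPoint, this, hj]

theorem fst_aeval_jetPoint (x : σ → κ) (j : σ) (f : MvPolynomial σ K) :
    (aeval (jetPoint x j) f).fst = aeval x f := by
  induction f using MvPolynomial.induction_on with
  | C a => simp [TrivSqZeroExt.algebraMap_eq_inl']
  | add f g hf hg => simp [hf, hg]
  | mul_X f i hf => simp [hf, jetPoint]

theorem snd_aeval_jetPoint (x : σ → κ) (j : σ) (f : MvPolynomial σ K) (l : {l : σ // l ≠ j}) :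
    (aeval (jetPoint x j) f).snd l = aeval x (pderiv l.1 f) := by
  induction f using MvPolynomial.induction_on with
  | C a => simp [TrivSqZeroExt.algebraMap_eq_inl']
  | add f g hf hg => simp [hf, hg]
  | mul_X f i hf =>
    simp only [map_mul, aeval_X, TrivSqZeroExt.snd_mul, fst_aeval_jetPoint, Pi.add_apply,
      Pi.smul_apply, hf, Derivation.leibniz, pderiv_X, map_add, smul_eq_mul]
    simp [jetPoint, Pi.single_apply, eq_comm, mul_comm]

theorem aeval_jetPoint_surjective [Finite κ] [Finite σ] (x : σ → κ) (j : σ)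
    (hx : Function.Surjective (aeval x : MvPolynomial σ K → κ)) :
    Function.Surjective (aeval (jetPoint x j) :
      MvPolynomial σ K → TrivSqZeroExt κ ({l : σ // l ≠ j} → κ)) := by
  have := Fintype.ofFinite κ
  have := Fintype.ofFinite σ
  set φ : MvPolynomial σ K →ₐ[K] TrivSqZeroExt κ ({l : σ // l ≠ j} → κ) := aeval (jetPoint x j)
    with hφ
  have hinl (a : κ) : TrivSqZeroExt.inl a ∈ φ.range := by
    obtain ⟨f, hf⟩ := hx a
    refine ⟨f ^ Fintype.card κ, ?_⟩
    change φ (f ^ Fintype.card κ) = _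
    rw [map_pow]
    ext1
    · rw [TrivSqZeroExt.fst_pow, hφ, fst_aeval_jetPoint, hf, FiniteField.pow_card]
      simp
    · rw [TrivSqZeroExt.snd_pow, ← Nat.cast_smul_eq_nsmul κ, FiniteField.cast_card_eq_zero]
      simp
  have hinr (l : {l : σ // l ≠ j}) : TrivSqZeroExt.inr (Pi.single l (1 : κ)) ∈ φ.range := by
    have h : (TrivSqZeroExt.inr (Pi.single l (1 : κ)) :
        TrivSqZeroExt κ ({l : σ // l ≠ j} → κ)) = φ (X l.1) - TrivSqZeroExt.inl (x l.1) := by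
      rw [hφ, aeval_X, jetPoint, add_sub_cancel_left]
      congr 1
      ext i
      simp [Pi.single_apply, Subtype.ext_iff]
    rw [h]
    exact sub_mem ⟨_, rfl⟩ (hinl _)
  intro z
  change z ∈ φ.range
  have hz : z = TrivSqZeroExt.inl z.fst +
      ∑ l, TrivSqZeroExt.inl (z.snd l) * TrivSqZeroExt.inr (Pi.single l (1 : κ)) := by
    conv_lhs => rw [← TrivSqZeroExt.inl_fst_add_inr_snd_eq z]
    congr 1
    simp only [TrivSqZeroExt.inl_mul_inr]
    rw [← TrivSqZeroExt.inr_sum]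
    congr 1
    ext i
    simp [Finset.sum_apply, Pi.single_apply]
  rw [hz]
  exact add_mem (hinl _) (sum_mem fun l _ => mul_mem (hinl _) (hinr l))

theorem finrank_jet [Module.Finite K κ] [Fintype σ] (j : σ) :
    Module.finrank K (TrivSqZeroExt κ ({l : σ // l ≠ j} → κ)) =
      Fintype.card σ * Module.finrank K κ := by
  change Module.finrank K (κ × ({l : σ // l ≠ j} → κ)) = _
  have : 0 < Fintype.card σ := Fintype.card_pos_iff.2 ⟨j⟩
  rw [Module.finrank_prod, Module.finrank_pi_fintype]
  obtain ⟨n, hn⟩ := Nat.exists_eq_succ_of_ne_zero this.ne'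
  simp [hn]
  ring

omit [DecidableEq σ] in
theorem moduleFinite_jet [Module.Finite K κ] [Finite σ] (j : σ) :
    Module.Finite K (TrivSqZeroExt κ ({l : σ // l ≠ j} → κ)) :=
  inferInstanceAs (Module.Finite K (κ × ({l : σ // l ≠ j} → κ)))

end FirstOrderJet

theorem finite_homogeneousSubmodule_s11 (m d : ℕ) :
    Finite (homogeneousSubmodule (Fin (m + 1)) F d) := by
  have : Module.Finite F (homogeneousSubmodule (Fin (m + 1)) F d) :=
    Module.Finite.of_fg (homogeneousSubmodule_fg (σ := Fin (m + 1)) (R := F) d)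
  exact Module.finite_of_finite F

theorem WPairs_finite (m k : ℕ) : (WPairs F m k).Finite := by
  have h4 := finite_homogeneousSubmodule_s11 F m (4 * k)
  have h6 := finite_homogeneousSubmodule_s11 F m (6 * k)
  exact (Set.Finite.prod (s := (homogeneousSubmodule (Fin (m + 1)) F (4 * k) : Set _))
    (t := (homogeneousSubmodule (Fin (m + 1)) F (6 * k) : Set _)) (Set.toFinite _)
    (Set.toFinite _)).subset fun AB h => ⟨h.1, h.2⟩

theorem card_WPairs_pos (m k : ℕ) : 0 < Nat.card (WPairs F m k) := by
  have := (WPairs_finite F m k).to_subtype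
  have : Nonempty (WPairs F m k) := ⟨⟨0, isHomogeneous_zero _ _ _, isHomogeneous_zero _ _ _⟩⟩
  exact Nat.card_pos

variable {F}

/-- The conditions that singularity with `x`-coordinate `x` over `pt` imposes on the first
order jet of `B` at `pt` once `A` is given. -/
def JetCondition (m : ℕ) (A B : MvPolynomial (Fin (m + 1)) F)
    (pt : Fin (m + 1) → AlgebraicClosure F) (x : AlgebraicClosure F) : Prop :=
  aeval pt B = -(x ^ 3 + aeval pt A * x) ∧
    ∀ i, aeval pt (pderiv i B) = -(aeval pt (pderiv i A) * x)

omit [Fintype F] in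
theorem SingAt.exists_jetCondition {m : ℕ} {A B : MvPolynomial (Fin (m + 1)) F}
    {pt : Fin (m + 1) → AlgebraicClosure F} (h2 : (2 : F) ≠ 0) (h : SingAt F m A B pt) :
    ∃ x, 3 * x ^ 2 + aeval pt A = 0 ∧ JetCondition m A B pt x := by
  obtain ⟨x, y, h1, hy, hA, hB⟩ := h
  have h2' : (2 : AlgebraicClosure F) ≠ 0 := by
    have h := (map_ne_zero (algebraMap F (AlgebraicClosure F))).2 h2
    rwa [map_ofNat] at h
  have hy0 : y = 0 := (mul_eq_zero.1 hy).resolve_left h2'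
  refine ⟨x, hA, ?_, fun i => ?_⟩
  · rw [hy0] at h1
    linear_combination -h1
  · linear_combination hB i

omit [Fintype F] in
theorem jetCondition_or_neg_of_sq_eq {m : ℕ} (h3 : (3 : F) ≠ 0)
    {A B : MvPolynomial (Fin (m + 1)) F} {pt : Fin (m + 1) → AlgebraicClosure F}
    {x x' : AlgebraicClosure F} (hx : 3 * x ^ 2 + aeval pt A = 0)
    (hx' : 3 * x' ^ 2 + aeval pt A = 0) (h : JetCondition m A B pt x) :
    JetCondition m A B pt x' ∨ JetCondition m A B pt (-x') := by
  have h3' : (3 : AlgebraicClosure F) ≠ 0 := by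
    have h := (map_ne_zero (algebraMap F (AlgebraicClosure F))).2 h3
    rwa [map_ofNat] at h
  have hsq : x ^ 2 = x' ^ 2 := mul_left_cancel₀ h3' (by linear_combination hx - hx')
  rcases sq_eq_sq_iff_eq_or_eq_neg.1 hsq with rfl | rfl
  · exact Or.inl h
  · exact Or.inr h

omit [Fintype F] in
theorem aeval_jetPoint_eq_of_jetCondition {m : ℕ} {A B B' : MvPolynomial (Fin (m + 1)) F}
    {κ : Type} [Field κ] [Algebra F κ] [Algebra κ (AlgebraicClosure F)]
    [IsScalarTower F κ (AlgebraicClosure F)] (z : Fin (m + 1) → κ) (j : Fin (m + 1))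
    {x : AlgebraicClosure F}
    (h : JetCondition m A B (fun i => algebraMap κ (AlgebraicClosure F) (z i)) x)
    (h' : JetCondition m A B' (fun i => algebraMap κ (AlgebraicClosure F) (z i)) x) :
    aeval (jetPoint z j) B = aeval (jetPoint z j) B' := by
  have hmap (f : MvPolynomial (Fin (m + 1)) F) :
      aeval (fun i => algebraMap κ (AlgebraicClosure F) (z i)) f =
        algebraMap κ (AlgebraicClosure F) (aeval z f) :=
    aeval_algebraMap_apply (AlgebraicClosure F) z f
  have hinj := FaithfulSMul.algebraMap_injective κ (AlgebraicClosure F)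
  ext l
  · rw [fst_aeval_jetPoint, fst_aeval_jetPoint]
    apply hinj
    rw [← hmap, ← hmap, h.1, h'.1]
  · rw [snd_aeval_jetPoint, snd_aeval_jetPoint]
    apply hinj
    rw [← hmap, ← hmap, h.2, h'.2]

open Classical in
theorem card_singAt_mul_le {m k : ℕ} (h2 : (2 : F) ≠ 0) (h3 : (3 : F) ≠ 0)
    {κ : Type} [Field κ] [Algebra F κ] [Module.Finite F κ] [Algebra κ (AlgebraicClosure F)]
    [IsScalarTower F κ (AlgebraicClosure F)] (z : Fin (m + 1) → κ) {j : Fin (m + 1)}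
    (hj : z j = 1) (hz : Function.Surjective (aeval z : MvPolynomial (Fin (m + 1)) F → κ))
    (hk : (m + 1) * Module.finrank F κ ≤ 6 * k) :
    Nat.card {AB ∈ WPairs F m k | SingAt F m AB.1 AB.2
        (fun i => algebraMap κ (AlgebraicClosure F) (z i))} *
      Fintype.card F ^ ((m + 1) * Module.finrank F κ) ≤ 2 * Nat.card (WPairs F m k) := by
  set pt : Fin (m + 1) → AlgebraicClosure F := fun i => algebraMap κ (AlgebraicClosure F) (z i)
  set J := TrivSqZeroExt κ ({l : Fin (m + 1) // l ≠ j} → κ)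
  have : Module.Finite F J := moduleFinite_jet j
  have : Finite κ := Module.finite_of_finite F
  have : Finite J := Module.finite_of_finite F
  have := (WPairs_finite F m k).to_subtype
  have hrank : Module.finrank F J = (m + 1) * Module.finrank F κ := by
    simpa using finrank_jet (K := F) (κ := κ) j
  have hcard : Nat.card J = Fintype.card F ^ ((m + 1) * Module.finrank F κ) := by
    rw [Module.natCard_eq_pow_finrank (K := F), hrank, Nat.card_eq_fintype_card]
  have hlift (w : J) : ∃ g : MvPolynomial (Fin (m + 1)) F,
      g.IsHomogeneous (6 * k) ∧ aeval (jetPoint z j) g = w := by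
    obtain ⟨f, rfl⟩ := aeval_jetPoint_surjective z j hz w
    exact exists_isHomogeneous_aeval_eq _ (jetPoint_self z hj) (hrank.trans_le hk) f
  choose g hg hgw using hlift
  have hroot (A : MvPolynomial (Fin (m + 1)) F) : ∃ x₀ : AlgebraicClosure F,
      ∀ x, 3 * x ^ 2 + aeval pt A = 0 → 3 * x₀ ^ 2 + aeval pt A = 0 := by
    by_cases h : ∃ x : AlgebraicClosure F, 3 * x ^ 2 + aeval pt A = 0
    · exact ⟨h.choose, fun _ _ => h.choose_spec⟩
    · exact ⟨0, fun x hx => absurd ⟨x, hx⟩ h⟩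
  choose x₀ hx₀ using hroot
  have hsing {A B : MvPolynomial (Fin (m + 1)) F} (h : SingAt F m A B pt) :
      JetCondition m A B pt (x₀ A) ∨ JetCondition m A B pt (-x₀ A) := by
    obtain ⟨x, hx, hB⟩ := h.exists_jetCondition h2
    exact jetCondition_or_neg_of_sq_eq h3 hx (hx₀ A x hx) hB
  rw [← hcard, ← Nat.card_prod, ← Nat.card_eq_two_iff.2 ⟨false, true, by simp, by ext; simp⟩,
    ← Nat.card_prod]
  refine Nat.card_le_card_of_injective (fun a : {AB ∈ WPairs F m k | SingAt F m AB.1 AB.2 pt} × J =>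
    ((decide (JetCondition m a.1.1.1 a.1.1.2 pt (x₀ a.1.1.1)),
      ⟨(a.1.1.1, a.1.1.2 + g a.2), a.1.2.1.1, a.1.2.1.2.add (hg a.2)⟩) : Bool × WPairs F m k)) ?_
  rintro ⟨⟨⟨A, B⟩, hAB, hs⟩, w⟩ ⟨⟨⟨A', B'⟩, hAB', hs'⟩, w'⟩ h
  have hsgn := decide_eq_decide.1 (congrArg Prod.fst h)
  have hA : A = A' := congrArg (fun t => t.2.1.1) h
  have hsum : B + g w = B' + g w' := congrArg (fun t => t.2.1.2) h
  subst hA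
  have hB : aeval (jetPoint z j) B = aeval (jetPoint z j) B' := by
    by_cases hp : JetCondition m A B pt (x₀ A)
    · exact aeval_jetPoint_eq_of_jetCondition z j hp (hsgn.1 hp)
    · exact aeval_jetPoint_eq_of_jetCondition z j ((hsing hs).resolve_left hp)
        ((hsing hs').resolve_left (mt hsgn.2 hp))
  have hw : w = w' := by
    have := congrArg (aeval (jetPoint z j)) hsum
    rwa [map_add, map_add, hB, hgw, hgw, add_right_inj] at this
  subst hw
  rw [add_left_inj] at hsum
  subst hsum
  rfl

theorem MvPolynomial.IsHomogeneous.aeval_mul_left {σ K L : Type*} [Field K] [Field L]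
    [Algebra K L] {f : MvPolynomial σ K} {n : ℕ} (hf : f.IsHomogeneous n) (c : L) (x : σ → L) :
    MvPolynomial.aeval (fun i => c * x i) f = c ^ n * MvPolynomial.aeval x f := by
  rw [aeval_def, aeval_def, eval₂_eq, eval₂_eq, Finset.mul_sum]
  refine Finset.sum_congr rfl fun d hd => ?_
  have hdeg := hf.degree_eq_sum_deg_support hd
  simp_rw [mul_pow, Finset.prod_mul_distrib, Finset.prod_pow_eq_pow_sum]
  rw [hdeg]
  ring

omit [Fintype F] in
theorem SingAt.mul_left {m k : ℕ} {A B : MvPolynomial (Fin (m + 1)) F}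
    {pt : Fin (m + 1) → AlgebraicClosure F} (hk : 0 < k) (hA : A.IsHomogeneous (4 * k))
    (hB : B.IsHomogeneous (6 * k)) (h : SingAt F m A B pt) (c : AlgebraicClosure F) :
    SingAt F m A B (fun i => c * pt i) := by
  obtain ⟨x, y, h1, h2, h3, h4⟩ := h
  refine ⟨c ^ (2 * k) * x, c ^ (3 * k) * y, ?_, ?_, ?_, fun i => ?_⟩
  · rw [hA.aeval_mul_left, hB.aeval_mul_left]
    linear_combination c ^ (6 * k) * h1
  · linear_combination c ^ (3 * k) * h2
  · rw [hA.aeval_mul_left]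
    linear_combination c ^ (4 * k) * h3
  · rw [hA.pderiv.aeval_mul_left, hB.pderiv.aeval_mul_left]
    have hexp : 6 * k - 1 = (4 * k - 1) + 2 * k := by omega
    rw [hexp, pow_add]
    linear_combination c ^ (4 * k - 1) * c ^ (2 * k) * h4 i

variable (F) in
/-- The vectors normalised to have coordinate `1` at `j` whose coordinates generate an
extension of degree `e`. -/
def normalizedPoints (m e : ℕ) (j : Fin (m + 1)) : Set (Fin (m + 1) → AlgebraicClosure F) :=
  {z | z j = 1 ∧ Module.finrank F (IntermediateField.adjoin F (Set.range z)) = e}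

omit [Fintype F] in
theorem finiteDimensional_adjoin_range {m : ℕ} (z : Fin (m + 1) → AlgebraicClosure F) :
    FiniteDimensional F (IntermediateField.adjoin F (Set.range z)) :=
  IntermediateField.finiteDimensional_adjoin fun x _ => Algebra.IsIntegral.isIntegral x

omit [Fintype F] in
theorem pos_of_mem_normalizedPoints {m e : ℕ} {j : Fin (m + 1)}
    {z : Fin (m + 1) → AlgebraicClosure F} (hz : z ∈ normalizedPoints F m e j) : 0 < e := by
  have := finiteDimensional_adjoin_range z
  rw [← hz.2]
  exact Module.finrank_pos

theorem normalizedPoints_finite_and_card_le (m e : ℕ) (j : Fin (m + 1)) :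
    (normalizedPoints F m e j).Finite ∧
      Nat.card (normalizedPoints F m e j) ≤ (Fintype.card F ^ e) ^ m := by
  classical
  set P : Polynomial (AlgebraicClosure F) := Polynomial.X ^ (Fintype.card F ^ e) - Polynomial.X
  have hq : 1 < Fintype.card F := Fintype.one_lt_card
  have hroot (z : normalizedPoints F m e j) (i : Fin (m + 1)) : z.1 i ∈ P.roots.toFinset := by
    obtain ⟨z, hz⟩ := z
    have he := pos_of_mem_normalizedPoints hz
    have := finiteDimensional_adjoin_range z
    have : Finite (IntermediateField.adjoin F (Set.range z)) := Module.finite_of_finite F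
    have := Fintype.ofFinite (IntermediateField.adjoin F (Set.range z))
    have hcard : Fintype.card (IntermediateField.adjoin F (Set.range z)) =
        Fintype.card F ^ e := by
      rw [Module.card_eq_pow_finrank (K := F), hz.2]
    have hpow := FiniteField.pow_card
      (⟨z i, IntermediateField.subset_adjoin F _ ⟨i, rfl⟩⟩ :
        IntermediateField.adjoin F (Set.range z))
    rw [hcard] at hpow
    have hpow' : z i ^ (Fintype.card F ^ e) = z i := congrArg Subtype.val hpow
    rw [Multiset.mem_toFinset, Polynomial.mem_roots
      (FiniteField.X_pow_card_pow_sub_X_ne_zero _ he.ne' hq)]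
    simp [hpow']
  have hcardP : P.roots.toFinset.card ≤ Fintype.card F ^ e := by
    refine (Multiset.toFinset_card_le _).trans ((Polynomial.card_roots' _).trans ?_)
    refine (Polynomial.natDegree_sub_le _ _).trans ?_
    have : 1 ≤ Fintype.card F ^ e := Nat.one_le_pow _ _ (by omega)
    simpa using this
  let φ : normalizedPoints F m e j → (Fin m → P.roots.toFinset) :=
    fun z i => ⟨z.1 (j.succAbove i), hroot z _⟩
  have hφ : Function.Injective φ := by
    intro z z' h
    ext i
    rcases Fin.eq_self_or_eq_succAbove j i with rfl | ⟨i, rfl⟩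
    · rw [z.2.1, z'.2.1]
    · exact congrArg Subtype.val (congrFun h i)
  refine ⟨Set.finite_coe_iff.1 ?_, ?_⟩
  · exact Finite.of_injective φ hφ
  · refine (Nat.card_le_card_of_injective φ hφ).trans ?_
    rw [Nat.card_eq_fintype_card, Fintype.card_fun, Fintype.card_fin, Fintype.card_coe]
    exact Nat.pow_le_pow_left hcardP m

theorem card_singAt_normalizedPoint_mul_le {m k e : ℕ} (h2 : (2 : F) ≠ 0) (h3 : (3 : F) ≠ 0)
    {j : Fin (m + 1)} {z : Fin (m + 1) → AlgebraicClosure F}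
    (hz : z ∈ normalizedPoints F m e j) (hk : (m + 1) * e ≤ 6 * k) :
    Nat.card {AB ∈ WPairs F m k | SingAt F m AB.1 AB.2 z} * Fintype.card F ^ ((m + 1) * e) ≤
      2 * Nat.card (WPairs F m k) := by
  obtain ⟨hj, rfl⟩ := hz
  have := finiteDimensional_adjoin_range z
  let w (i : Fin (m + 1)) : IntermediateField.adjoin F (Set.range z) :=
    ⟨z i, IntermediateField.subset_adjoin F _ ⟨i, rfl⟩⟩
  have hw : Function.Surjective (aeval w : MvPolynomial (Fin (m + 1)) F → _) := by
    rintro ⟨a, ha⟩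
    rw [← IntermediateField.mem_toSubalgebra, IntermediateField.adjoin_toSubalgebra_of_isAlgebraic
      fun x _ => Algebra.IsAlgebraic.isAlgebraic x, Algebra.adjoin_range_eq_range_aeval] at ha
    obtain ⟨f, hf⟩ := ha
    refine ⟨f, Subtype.ext ?_⟩
    exact (aeval_algebraMap_apply (AlgebraicClosure F) w f).symm.trans hf
  exact card_singAt_mul_le h2 h3 w (Subtype.ext hj) hw hk

omit [Fintype F] in
theorem gfrac_nonneg (m r k : ℕ) : 0 ≤ gfrac F m r k := by
  unfold gfrac
  positivity

open Classical in
theorem gfrac_le (h2 : (2 : F) ≠ 0) (h3 : (3 : F) ≠ 0) (m r k : ℕ) :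
    gfrac F m r k ≤ 4 * (m + 1) * (1 / 2) ^ r := by
  set W := (WPairs_finite F m k).toFinset
  set q := Fintype.card F
  have hq : 2 ≤ q := Fintype.one_lt_card
  have hW : Nat.card (WPairs F m k) = W.card := Nat.card_eq_card_finite_toFinset _
  have hWpos : (0 : ℝ) < W.card := by
    exact_mod_cast hW ▸ card_WPairs_pos F m k
  have hfilter (Q : MvPolynomial (Fin (m + 1)) F × MvPolynomial (Fin (m + 1)) F → Prop) :
      Nat.card {AB ∈ WPairs F m k | Q AB} = (W.filter Q).card := by
    rw [Nat.card_eq_card_finite_toFinset ((WPairs_finite F m k).subset (Set.sep_subset _ _))]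
    congr 1
    ext AB
    simp [W]
  set P := fun e j => (normalizedPoints_finite_and_card_le (F := F) m e j).1.toFinset
  have hP (e : ℕ) (j : Fin (m + 1)) : (P e j).card ≤ (q ^ e) ^ m := by
    rw [← Nat.card_eq_card_finite_toFinset]
    exact (normalizedPoints_finite_and_card_le m e j).2
  have hpoint (e : ℕ) (he : e * (6 * (m + 1)) ≤ k) (j : Fin (m + 1)) :
      ∑ z ∈ P e j, ((W.filter fun AB => SingAt F m AB.1 AB.2 z).card : ℝ) ≤
        2 * W.card * (1 / 2) ^ e := by
    have hbound (z) (hz : z ∈ P e j) :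
        ((W.filter fun AB => SingAt F m AB.1 AB.2 z).card : ℝ) ≤
          2 * W.card / (q : ℝ) ^ ((m + 1) * e) := by
      have h := card_singAt_normalizedPoint_mul_le (k := k) h2 h3
        ((Set.Finite.mem_toFinset _).1 hz) (by nlinarith)
      rw [hfilter, hW] at h
      rw [le_div_iff₀ (by positivity)]
      exact_mod_cast h
    refine (Finset.sum_le_card_nsmul _ _ _ hbound).trans ?_
    have hP' : ((P e j).card : ℝ) ≤ ((q : ℝ) ^ e) ^ m := by exact_mod_cast hP e j
    have hq0 : (0 : ℝ) < q := by positivity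
    calc (P e j).card • (2 * W.card / (q : ℝ) ^ ((m + 1) * e))
        ≤ ((q : ℝ) ^ e) ^ m * (2 * W.card / (q : ℝ) ^ ((m + 1) * e)) := by
          rw [nsmul_eq_mul]
          gcongr
      _ = 2 * W.card * (1 / (q : ℝ)) ^ e := by
          rw [one_div, inv_pow, add_mul, one_mul, pow_add, ← pow_mul, mul_comm e m]
          field_simp
      _ ≤ 2 * W.card * (1 / 2) ^ e := by
          have : (2 : ℝ) ≤ q := by exact_mod_cast hq
          gcongr
  set E := Finset.Ico r (k / (6 * (m + 1)) + 1)
  set bad := W.filter fun AB => ∃ (pt : Fin (m + 1) → AlgebraicClosure F)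
      (_ : pt ≠ 0) (j : Fin (m + 1)), pt j ≠ 0 ∧
      r ≤ degPt F m pt j ∧ 6 * (m + 1) * degPt F m pt j ≤ k ∧ SingAt F m AB.1 AB.2 pt
  have hsub : bad ⊆ E.biUnion fun e => Finset.univ.biUnion fun j => (P e j).biUnion fun z =>
      W.filter fun AB => SingAt F m AB.1 AB.2 z := by
    intro AB hAB
    obtain ⟨hABW, pt, -, j, hj, hr, hk, hs⟩ := Finset.mem_filter.1 hAB
    have hz : (fun i => pt i / pt j) ∈ normalizedPoints F m (degPt F m pt j) j :=
      ⟨div_self hj, rfl⟩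
    have hpos := pos_of_mem_normalizedPoints hz
    have hAB' := (Set.Finite.mem_toFinset _).1 hABW
    have hs' := hs.mul_left (k := k) (by nlinarith) hAB'.1 hAB'.2 (pt j)⁻¹
    simp only [Finset.mem_biUnion, Finset.mem_filter, Finset.mem_univ, true_and]
    refine ⟨degPt F m pt j, Finset.mem_Ico.2 ⟨hr, Nat.lt_succ_of_le ?_⟩, j, _,
      (Set.Finite.mem_toFinset _).2 hz, hABW, ?_⟩
    · rw [Nat.le_div_iff_mul_le (by positivity)]
      linarith
    · simpa only [div_eq_inv_mul] using hs'
  have hcard : (bad.card : ℝ) ≤ ∑ e ∈ E, ∑ j : Fin (m + 1), ∑ z ∈ P e j,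
      ((W.filter fun AB => SingAt F m AB.1 AB.2 z).card : ℝ) := by
    exact_mod_cast (Finset.card_le_card hsub).trans <| Finset.card_biUnion_le.trans <|
      Finset.sum_le_sum fun e _ => Finset.card_biUnion_le.trans <|
        Finset.sum_le_sum fun j _ => Finset.card_biUnion_le
  unfold gfrac
  rw [hfilter, hW, div_le_iff₀ hWpos]
  calc (bad.card : ℝ)
      ≤ ∑ e ∈ E, ∑ j : Fin (m + 1), 2 * W.card * (1 / 2 : ℝ) ^ e := by
        refine hcard.trans (Finset.sum_le_sum fun e he => Finset.sum_le_sum fun j _ => ?_)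
        refine hpoint e ?_ j
        rw [← Nat.le_div_iff_mul_le (by positivity)]
        exact Nat.lt_succ_iff.1 (Finset.mem_Ico.1 he).2
    _ = 2 * W.card * (m + 1) * ∑ e ∈ E, (1 / 2 : ℝ) ^ e := by
        rw [Finset.mul_sum]
        refine Finset.sum_congr rfl fun e _ => ?_
        simp
        ring
    _ ≤ 2 * W.card * (m + 1) * ((1 / 2) ^ r / (1 - 1 / 2)) := by
        gcongr
        exact geom_sum_Ico_le_of_lt_one (by norm_num) (by norm_num)
    _ = 4 * (m + 1) * (1 / 2) ^ r * W.card := by ring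

/-- `lim_{r→∞} limsup_{k→∞} g_r(k) = 0` for the fractions of
Weierstrass pairs of level `k` singular over some point of intermediate degree. -/
theorem stmt11 (p : ℕ) (hp : p.Prime) (hp3 : 3 < p) [CharP F p] (m : ℕ) (hm : 1 ≤ m) :
    Tendsto (fun r : ℕ => atTop.limsup fun k : ℕ => gfrac F m r k) atTop (nhds 0) := by
  have hne (n : ℕ) (hn : 0 < n) (hnp : n < p) : (n : F) ≠ 0 := fun h =>
    Nat.not_dvd_of_pos_of_lt hn hnp ((CharP.cast_eq_zero_iff F p n).1 h)
  have h2 : (2 : F) ≠ 0 := by exact_mod_cast hne 2 (by norm_num) (by omega)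
  have h3 : (3 : F) ≠ 0 := by exact_mod_cast hne 3 (by norm_num) hp3
  have hlim : Tendsto (fun r : ℕ => 4 * ((m : ℝ) + 1) * (1 / 2) ^ r) atTop (nhds 0) := by
    simpa using (tendsto_pow_atTop_nhds_zero_of_lt_one (r := (1 / 2 : ℝ)) (by norm_num)
      (by norm_num)).const_mul (4 * ((m : ℝ) + 1))
  refine squeeze_zero (fun r => ?_) (fun r => ?_) hlim
  · exact le_limsup_of_frequently_le (Frequently.of_forall fun k => gfrac_nonneg m r k)
      (isBoundedUnder_of ⟨_, gfrac_le h2 h3 m r⟩)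
  · exact limsup_le_of_le (isCoboundedUnder_le_of_le atTop (gfrac_nonneg m r))
      (Eventually.of_forall (gfrac_le h2 h3 m r))
end
end

section
/- Let q be a power of 2, let m ≥ 1 and k ≥ 1 be integers, and let r = (r_1,…,r_m) ∈ (𝔽_q)^m be an 𝔽_q-rational point of the affine chart of ℙ^m. Consider quadruples (A₁, A₃, A₄, A₆) of homogeneous polynomials over 𝔽_q in x_0,…,x_m of degrees k, 3k, 4k, 6k respectively, with dehomogenizations (a₁, a₃, a₄, a₆) obtained by setting x_0 = 1. Then the fraction of such quadruples for which there exist x, y ∈ 𝔽̄_q with y² + a₁(r)xy + a₃(r)y = x³ + a₄(r)x + a₆(r), 2y + a₁(r)x + a₃(r) = 0, a₁(r)·y = 3x² + a₄(r), and (∂a₁/∂u_j)(r)·x·y + (∂a₃/∂u_j)(r)·y = (∂a₄/∂u_j)(r)·x + (∂a₆/∂u_j)(r) for all j = 1,…,m, is exactly q^{-(m+1)}. -/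
open MvPolynomial Filter

noncomputable section

variable (F : Type) [Field F] [Fintype F]

/-- The set of quadruples `(A₁, A₃, A₄, A₆)` of homogeneous polynomials of degrees
`k, 3k, 4k, 6k` in `m + 1` variables. -/
def WQuadruples (m k : ℕ) :
    Set (MvPolynomial (Fin (m + 1)) F × MvPolynomial (Fin (m + 1)) F ×
      MvPolynomial (Fin (m + 1)) F × MvPolynomial (Fin (m + 1)) F) :=
  {T | T.1.IsHomogeneous k ∧ T.2.1.IsHomogeneous (3 * k) ∧
    T.2.2.1.IsHomogeneous (4 * k) ∧ T.2.2.2.IsHomogeneous (6 * k)}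

/-- In characteristic 2, the Weierstrass hypersurface
`y² + a₁xy + a₃y = x³ + a₄x + a₆` (with `aᵢ` the dehomogenization of `Aᵢ`) is
singular at a point lying over the `𝔽_q`-rational affine point `r`. -/
def SingAtAff2 (m : ℕ) (A₁ A₃ A₄ A₆ : MvPolynomial (Fin (m + 1)) F)
    (r : Fin m → F) : Prop :=
  ∃ x y : AlgebraicClosure F,
    (letI ρ : Fin m → AlgebraicClosure F := fun j => algebraMap F (AlgebraicClosure F) (r j)
    y ^ 2 + aeval ρ (dehom F m A₁) * x * y + aeval ρ (dehom F m A₃) * y =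
        x ^ 3 + aeval ρ (dehom F m A₄) * x + aeval ρ (dehom F m A₆) ∧
      2 * y + aeval ρ (dehom F m A₁) * x + aeval ρ (dehom F m A₃) = 0 ∧
      aeval ρ (dehom F m A₁) * y = 3 * x ^ 2 + aeval ρ (dehom F m A₄) ∧
      ∀ j, aeval ρ (pderiv j (dehom F m A₁)) * x * y + aeval ρ (pderiv j (dehom F m A₃)) * y =
        aeval ρ (pderiv j (dehom F m A₄)) * x + aeval ρ (pderiv j (dehom F m A₆)))

section JetCounting

/-- The singularity condition of a characteristic 2 Weierstrass hypersurface over a point, in terms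
of the values `aᵢ` and the gradients `bᵢ` of its coefficients there. -/
def JetSingular {K ι : Type*} [Field K] (a₁ a₃ a₄ a₆ : K) (b₁ b₃ b₄ b₆ : ι → K) : Prop :=
  ∃ x y : K, y ^ 2 + a₁ * x * y + a₃ * y = x ^ 3 + a₄ * x + a₆ ∧
    2 * y + a₁ * x + a₃ = 0 ∧ a₁ * y = 3 * x ^ 2 + a₄ ∧
    ∀ j, b₁ j * x * y + b₃ j * y = b₄ j * x + b₆ j

theorem exists_sq_eq_of_charP_two {F : Type*} [Field F] [Finite F] [CharP F 2] (a : F) :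
    ∃ s : F, s ^ 2 = a := by
  obtain ⟨s, hs⟩ := FiniteField.isSquare_of_char_two (ringChar.eq F 2) a
  exact ⟨s, by rw [hs, sq]⟩

theorem eq_of_sq_eq_of_charP_two {K : Type*} [Field K] [CharP K 2] {a b : K}
    (h : a ^ 2 = b ^ 2) : a = b :=
  CharTwo.sq_injective h

theorem jetSingular_map_iff {F K ι : Type*} [Field F] [Finite F] [CharP F 2] [Field K]
    (i : F →+* K) (a₁ a₃ a₄ a₆ : F) (b₁ b₃ b₄ b₆ : ι → F) :
    JetSingular (i a₁) (i a₃) (i a₄) (i a₆) (i ∘ b₁) (i ∘ b₃) (i ∘ b₄) (i ∘ b₆) ↔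
      JetSingular a₁ a₃ a₄ a₆ b₁ b₃ b₄ b₆ := by
  have hK : CharP K 2 := charP_of_injective_ringHom i.injective 2
  have h2 : (2 : K) = 0 := CharTwo.two_eq_zero
  constructor
  · rintro ⟨x, y, h₁, h₃, h₄, hb⟩
    suffices H : ∃ x' y' : F, i x' = x ∧ i y' = y by
      obtain ⟨x, y, rfl, rfl⟩ := H
      refine ⟨x, y, ?_, ?_, ?_, fun j => ?_⟩ <;> apply i.injective
      · simpa using h₁
      · simpa [map_ofNat] using h₃
      · simpa [map_ofNat] using h₄
      · simpa using hb j
    by_cases h0 : a₁ = 0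
    · obtain ⟨s, hs⟩ := exists_sq_eq_of_charP_two a₄
      obtain ⟨t, ht⟩ := exists_sq_eq_of_charP_two a₆
      subst h0 hs ht
      simp only [map_zero, map_pow] at h₁ h₃ h₄
      have hx : i s = x := eq_of_sq_eq_of_charP_two
        (by linear_combination -h₄ - 2 * x ^ 2 * h2)
      refine ⟨s, t, hx, eq_of_sq_eq_of_charP_two ?_⟩
      rw [hx] at h₁
      linear_combination -h₁ + y * h₃ - y ^ 2 * h2 - x ^ 3 * h2
    · have h0' : i a₁ ≠ 0 := (map_ne_zero i).2 h0
      have hx : i (a₃ / a₁) = x := by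
        rw [map_div₀, div_eq_iff h0']
        linear_combination h₃ - (y + i a₁ * x) * h2
      refine ⟨a₃ / a₁, (3 * (a₃ / a₁) ^ 2 + a₄) / a₁, hx, ?_⟩
      rw [map_div₀, div_eq_iff h0', map_add, map_mul, map_pow, hx, map_ofNat]
      linear_combination -h₄
  · rintro ⟨x, y, h₁, h₃, h₄, hb⟩
    refine ⟨i x, i y, ?_, ?_, ?_, fun j => ?_⟩
    · simpa using congrArg i h₁
    · simpa [map_ofNat] using congrArg i h₃
    · simpa [map_ofNat] using congrArg i h₄
    · simpa using congrArg i (hb j)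

theorem existsUnique_jetSingular_of_ne_zero {K ι : Type*} [Field K] [CharP K 2] {a₁ : K}
    (h0 : a₁ ≠ 0) (a₃ a₄ a₆ : K) (b₁ b₃ b₄ b₆ : ι → K) :
    ∃! c : K × (ι → K), JetSingular a₁ a₃ a₄ (a₆ + c.1) b₁ b₃ b₄ (b₆ + c.2) := by
  have h2 : (2 : K) = 0 := CharTwo.two_eq_zero
  obtain ⟨x, hx⟩ : ∃ x, a₁ * x = a₃ := ⟨a₃ / a₁, mul_div_cancel₀ _ h0⟩
  obtain ⟨y, hy⟩ : ∃ y, a₁ * y = 3 * x ^ 2 + a₄ := ⟨_ / a₁, mul_div_cancel₀ _ h0⟩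
  refine ⟨(y ^ 2 + a₁ * x * y + a₃ * y - (x ^ 3 + a₄ * x + a₆),
    fun j => b₁ j * x * y + b₃ j * y - (b₄ j * x + b₆ j)),
    ⟨x, y, by ring, by linear_combination (y + a₃) * h2 + hx, hy, fun j => ?_⟩, ?_⟩
  · simp only [Pi.add_apply]
    ring
  · rintro ⟨c, d⟩ ⟨x', y', h₁, h₃, h₄, hb⟩
    obtain rfl : x' = x := mul_left_cancel₀ h0 (by linear_combination h₃ - hx - (y' + a₃) * h2)
    obtain rfl : y' = y := mul_left_cancel₀ h0 (h₄.trans hy.symm)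
    refine Prod.ext ?_ (funext fun j => ?_)
    · linear_combination -h₁
    · have := hb j
      simp only [Pi.add_apply] at this
      linear_combination -this

theorem existsUnique_jetSingular_of_zero {F ι : Type*} [Field F] [Finite F] [CharP F 2]
    (a₃ a₄ a₆ : F) (b₁ b₃ b₄ b₆ : ι → F) :
    ∃! c : F × (ι → F), JetSingular 0 (a₃ + c.1) a₄ a₆ b₁ b₃ b₄ (b₆ + c.2) := by
  have h2 : (2 : F) = 0 := CharTwo.two_eq_zero
  obtain ⟨x, rfl⟩ := exists_sq_eq_of_charP_two a₄
  obtain ⟨y, rfl⟩ := exists_sq_eq_of_charP_two a₆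
  refine ⟨(-a₃, fun j => b₁ j * x * y + b₃ j * y - (b₄ j * x + b₆ j)),
    ⟨x, y, by linear_combination -x ^ 3 * h2, by linear_combination y * h2,
      by linear_combination -2 * x ^ 2 * h2, fun j => ?_⟩, ?_⟩
  · simp only [Pi.add_apply]
    ring
  · rintro ⟨c, d⟩ ⟨x', y', h₁, h₃, h₄, hb⟩
    simp only at h₁ h₃ h₄ hb
    have h₃' : a₃ + c = 0 := by linear_combination h₃ - y' * h2
    obtain rfl : x' = x :=
      eq_of_sq_eq_of_charP_two (by linear_combination -h₄ - (x' ^ 2 + x ^ 2) * h2 )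
    obtain rfl : y' = y :=
      eq_of_sq_eq_of_charP_two (by linear_combination h₁ + x' ^ 3 * h2 - y' * h₃')
    refine Prod.ext ?_ (funext fun j => ?_)
    · linear_combination h₃'
    · have := hb j
      simp only [Pi.add_apply] at this
      linear_combination -this

variable {F : Type} [Field F] {m : ℕ}

theorem singAtAff2_iff_jetSingular [Finite F] [CharP F 2]
    (A₁ A₃ A₄ A₆ : MvPolynomial (Fin (m + 1)) F)
    (r : Fin m → F) :
    SingAtAff2 F m A₁ A₃ A₄ A₆ r ↔
      JetSingular (eval r (dehom F m A₁)) (eval r (dehom F m A₃)) (eval r (dehom F m A₄))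
        (eval r (dehom F m A₆)) (fun j => eval r (pderiv j (dehom F m A₁)))
        (fun j => eval r (pderiv j (dehom F m A₃))) (fun j => eval r (pderiv j (dehom F m A₄)))
        (fun j => eval r (pderiv j (dehom F m A₆))) := by
  have key (p : MvPolynomial (Fin m) F) :
      aeval (fun j => algebraMap F (AlgebraicClosure F) (r j)) p =
        algebraMap F (AlgebraicClosure F) (eval r p) :=
    aeval_algebraMap_apply (AlgebraicClosure F) r p
  rw [← jetSingular_map_iff (algebraMap F (AlgebraicClosure F))]
  simp only [SingAtAff2, JetSingular, key, Function.comp_apply]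

/-- A form of degree `d` whose dehomogenization has value `c.1` and gradient `c.2` at `r`. -/
def jetForm (r : Fin m → F) (d : ℕ) (c : F × (Fin m → F)) : MvPolynomial (Fin (m + 1)) F :=
  X 0 ^ (d - 1) * (C c.1 * X 0 + ∑ j, C (c.2 j) * (X j.succ - C (r j) * X 0))

theorem isHomogeneous_jetForm (r : Fin m → F) {d : ℕ} (hd : 1 ≤ d) (c : F × (Fin m → F)) :
    (jetForm r d c).IsHomogeneous d := by
  have hC (a : F) (j : Fin (m + 1)) : (C a * X j).IsHomogeneous 1 :=
    isHomogeneous_C_mul_X a j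
  have h := ((isHomogeneous_X F (0 : Fin (m + 1))).pow (d - 1)).mul
    ((hC c.1 0).add (IsHomogeneous.sum Finset.univ
      (fun j : Fin m => C (c.2 j) * (X j.succ - C (r j) * X 0)) 1 fun j _ => by
        simpa using (isHomogeneous_C (Fin (m + 1)) (c.2 j)).mul
          ((isHomogeneous_X F j.succ).sub (hC (r j) 0))))
  rw [show 1 * (d - 1) + 1 = d by omega] at h
  exact h

theorem dehom_jetForm (r : Fin m → F) (d : ℕ) (c : F × (Fin m → F)) :
    dehom F m (jetForm r d c) = C c.1 + ∑ j, C (c.2 j) * (X j - C (r j)) := by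
  simp [dehom, jetForm, algebraMap_eq]

theorem eval_dehom_jetForm (r : Fin m → F) (d : ℕ) (c : F × (Fin m → F)) :
    eval r (dehom F m (jetForm r d c)) = c.1 := by
  simp [dehom_jetForm]

theorem eval_pderiv_dehom_jetForm (r : Fin m → F) (d : ℕ) (c : F × (Fin m → F)) (j : Fin m) :
    eval r (pderiv j (dehom F m (jetForm r d c))) = c.2 j := by
  simp [dehom_jetForm, pderiv_X, Pi.single_apply, apply_ite]

open Classical in
/-- Translate the fourth coefficient by a form with 1-jet `c` at `r`; if `a₁(r) = 0`, the value part
of `c` is used to translate the second coefficient instead. -/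
def jetShift (k : ℕ) (r : Fin m → F) (c : F × (Fin m → F))
    (T : MvPolynomial (Fin (m + 1)) F × MvPolynomial (Fin (m + 1)) F ×
      MvPolynomial (Fin (m + 1)) F × MvPolynomial (Fin (m + 1)) F) :
    MvPolynomial (Fin (m + 1)) F × MvPolynomial (Fin (m + 1)) F ×
      MvPolynomial (Fin (m + 1)) F × MvPolynomial (Fin (m + 1)) F :=
  if eval r (dehom F m T.1) = 0 then
    (T.1, T.2.1 + jetForm r (3 * k) (c.1, 0), T.2.2.1, T.2.2.2 + jetForm r (6 * k) (0, c.2))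
  else (T.1, T.2.1, T.2.2.1, T.2.2.2 + jetForm r (6 * k) c)

theorem jetShift_mem {k : ℕ} (hk : 1 ≤ k) (r : Fin m → F) (c : F × (Fin m → F))
    {T} (hT : T ∈ WQuadruples F m k) : jetShift k r c T ∈ WQuadruples F m k := by
  obtain ⟨h₁, h₃, h₄, h₆⟩ := hT
  have h (c) := isHomogeneous_jetForm r (show 1 ≤ 3 * k by omega) c
  have h' (c) := isHomogeneous_jetForm r (show 1 ≤ 6 * k by omega) c
  unfold jetShift
  split_ifs
  · exact ⟨h₁, h₃.add (h _), h₄, h₆.add (h' _)⟩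
  · exact ⟨h₁, h₃, h₄, h₆.add (h' _)⟩

theorem jetShift_jetShift [CharP F 2] (k : ℕ) (r : Fin m → F) (c : F × (Fin m → F)) (T) :
    jetShift k r c (jetShift k r c T) = T := by
  by_cases h : eval r (dehom F m T.1) = 0 <;>
    simp [jetShift, h, add_assoc, CharTwo.add_self_eq_zero]

theorem existsUnique_singAtAff2_jetShift [Finite F] [CharP F 2] (k : ℕ) (r : Fin m → F) (T) :
    ∃! c, SingAtAff2 F m (jetShift k r c T).1 (jetShift k r c T).2.1
      (jetShift k r c T).2.2.1 (jetShift k r c T).2.2.2 r := by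
  simp only [singAtAff2_iff_jetSingular]
  by_cases h : eval r (dehom F m T.1) = 0
  · simp only [jetShift, h, if_true, map_add, eval_dehom_jetForm, eval_pderiv_dehom_jetForm,
      Pi.zero_apply, add_zero]
    exact existsUnique_jetSingular_of_zero _ _ _ _ _ _ _
  · simp only [jetShift, h, if_false, map_add, eval_dehom_jetForm, eval_pderiv_dehom_jetForm]
    exact existsUnique_jetSingular_of_ne_zero h _ _ _ _ _ _ _

end JetCounting

/-- in characteristic 2, for an `𝔽_q`-rational affine point `r` of
`ℙ^m`, the fraction of quadruples `(A₁, A₃, A₄, A₆)` whose Weierstrass hypersurface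
is singular over `r` is exactly `q^{-(m+1)}`. -/
theorem stmt14 [CharP F 2] (m : ℕ) (hm : 1 ≤ m) (k : ℕ) (hk : 1 ≤ k) (r : Fin m → F) :
    Fintype.card F ^ (m + 1) *
        Nat.card {T ∈ WQuadruples F m k | SingAtAff2 F m T.1 T.2.1 T.2.2.1 T.2.2.2 r} =
      Nat.card (WQuadruples F m k) := by
  have hcard : Fintype.card F ^ (m + 1) = Nat.card (F × (Fin m → F)) := by
    simp [Nat.card_eq_fintype_card, pow_succ']
  rw [hcard, ← Nat.card_prod]
  refine Nat.card_congr (Equiv.ofBijective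
    (fun p => ⟨jetShift k r p.1 p.2.1, jetShift_mem hk r p.1 p.2.2.1⟩) ⟨?_, ?_⟩)
  · rintro ⟨c, T, hT, hs⟩ ⟨c', T', hT', hs'⟩ h
    have h : jetShift k r c T = jetShift k r c' T' := congrArg Subtype.val h
    have hc : c = c' := (existsUnique_singAtAff2_jetShift k r (jetShift k r c T)).unique
      (by rwa [jetShift_jetShift]) (by rwa [h, jetShift_jetShift])
    subst hc
    have hTT : T = T' := by rw [← jetShift_jetShift k r c T, h, jetShift_jetShift]
    subst hTT
    rfl
  · rintro ⟨T, hT⟩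
    obtain ⟨c, hc, -⟩ := existsUnique_singAtAff2_jetShift k r T
    exact ⟨(c, ⟨jetShift k r c T, jetShift_mem hk r c hT, hc⟩),
      Subtype.ext (jetShift_jetShift k r c T)⟩
end
end
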